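/- Let Γ be a basic finite-dimensional algebra over a field with domdim Γ ≥ k, and let Π be a maximal projective-injective direct summand of Γ. Then there exists a basic Π-special k-tilting Γ-module T_k and a basic Π-special k-cotilting Γ-module C^k, and each of these modules is unique up to isomorphism. -/

import Mathlib

/-!
Formalization of definitions from "Special tilting modules for algebras with positive
dominant dimension" (Pressland–Sauter), together with one of its statements.
-/

open CategoryTheory

noncomputable section
namespace PS

variable {R : Type} [Ring R]

/-- `N` is (isomorphic to) a direct summand of `M`. -/
def IsSummand (N M : ModuleCat.{0} R) : Prop :=
  ∃ (ι : N →ₗ[R] M) (π : M →ₗ[R] N), π ∘ₗ ι = LinearMap.id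

/-- `M` lies in `add X`: it is a direct summand of a finite direct sum of copies of `X`. -/
def MemAdd (X M : ModuleCat.{0} R) : Prop :=
  ∃ n : ℕ, IsSummand M (ModuleCat.of R (Fin n → X))

/-- `M` is projective-injective. -/
def ProjInj (M : ModuleCat.{0} R) : Prop :=
  Module.Projective R M ∧ Module.Injective R M

/-- The regular left module. -/
def reg (R : Type) [Ring R] : ModuleCat.{0} R := ModuleCat.of R R

/-- A module is basic if no nonzero module `X` has `X ⊕ X` as a direct summand of it
(equivalently, for finite length modules, its indecomposable direct summands are pairwise
non-isomorphic). -/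
def IsBasic (M : ModuleCat.{0} R) : Prop :=
  ∀ X : ModuleCat.{0} R, IsSummand (ModuleCat.of R (X × X)) M → Subsingleton X

/-- `P` is a maximal projective-injective direct summand of the regular module. -/
def IsMaxProjInjSummand (P : ModuleCat.{0} R) : Prop :=
  IsSummand P (reg R) ∧ ProjInj P ∧
    ∀ Q : ModuleCat.{0} R, IsSummand Q (reg R) → ProjInj Q → MemAdd P Q

/-- The data `Y 0 → Y 1 → ⋯ → Y n` forms an exact sequence
`0 → Y 0 → Y 1 → ⋯ → Y n → 0` (with `n ≥ 1` maps; terms beyond `Y n` are ignored). -/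
def IsExactSeq (n : ℕ) (Y : ℕ → ModuleCat.{0} R) (f : ∀ i, Y i →ₗ[R] Y (i+1)) : Prop :=
  Function.Injective (f 0) ∧ Function.Surjective (f (n-1)) ∧
    ∀ i, i + 2 ≤ n → Function.Exact (f i) (f (i+1))

/-- The algebra `R` has dominant dimension at least `k`: the regular module has an
injective resolution whose first `k` terms are projective-injective. -/
def DomdimGE (R : Type) [Ring R] (k : ℕ) : Prop :=
  ∃ (Y : ℕ → ModuleCat.{0} R) (g : reg R →ₗ[R] Y 0) (f : ∀ i, Y i →ₗ[R] Y (i+1)),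
    Function.Injective g ∧ Function.Exact g (f 0) ∧
    (∀ i, Function.Exact (f i) (f (i+1))) ∧
    (∀ i, Module.Injective R (Y i)) ∧ (∀ i, i < k → Module.Projective R (Y i))

/-- `domdim R = d`. -/
def DomdimEq (R : Type) [Ring R] (d : ℕ) : Prop :=
  DomdimGE R d ∧ ¬ DomdimGE R (d+1)

/-- The Ext group `Ext^j(M, N)` in the category of `R`-modules. -/
def ext (M N : ModuleCat.{0} R) (j : ℕ) : Type :=
  ((Ext ℤ (ModuleCat.{0} R) j).obj (Opposite.op M)).obj N

/-- `Ext^j(M, N) = 0` (for a single `j`). -/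
def ExtZero (M N : ModuleCat.{0} R) (j : ℕ) : Prop := Subsingleton (ext M N j)

/-- `Ext^j(M, N) = 0` for all `j ≥ 1`. -/
def ExtVanishing (M N : ModuleCat.{0} R) : Prop :=
  ∀ j : ℕ, 1 ≤ j → ExtZero M N j

/-- Projective dimension at most `k`. -/
def PdimLE (k : ℕ) (M : ModuleCat.{0} R) : Prop :=
  ∃ (Y : ℕ → ModuleCat.{0} R) (f : ∀ i, Y i →ₗ[R] Y (i+1)),
    IsExactSeq (k+1) Y f ∧ (∀ i, i ≤ k → Module.Projective R (Y i)) ∧ Y (k+1) = M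

/-- Injective dimension at most `k`. -/
def IdimLE (k : ℕ) (M : ModuleCat.{0} R) : Prop :=
  ∃ (Y : ℕ → ModuleCat.{0} R) (f : ∀ i, Y i →ₗ[R] Y (i+1)),
    IsExactSeq (k+1) Y f ∧ (∀ i, 1 ≤ i → i ≤ k+1 → Module.Injective R (Y i)) ∧ Y 0 = M

/-- `T` is a `k`-tilting module. -/
def IsTilting (k : ℕ) (T : ModuleCat.{0} R) : Prop :=
  Module.Finite R T ∧ PdimLE k T ∧ ExtVanishing T T ∧
    ∃ (Y : ℕ → ModuleCat.{0} R) (f : ∀ i, Y i →ₗ[R] Y (i+1)),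
      IsExactSeq (k+1) Y f ∧ Y 0 = reg R ∧ ∀ i, 1 ≤ i → i ≤ k+1 → MemAdd T (Y i)

/-- `T` is a `P`-special `k`-tilting module: it is `k`-tilting, and there is a coresolution
`0 → R → t_0 → ⋯ → t_k → 0` with all `t_j ∈ add T` and `t_j ∈ add P` for `j ≤ k-1`. -/
def IsSpecialTilting (P : ModuleCat.{0} R) (k : ℕ) (T : ModuleCat.{0} R) : Prop :=
  IsTilting k T ∧
    ∃ (Y : ℕ → ModuleCat.{0} R) (f : ∀ i, Y i →ₗ[R] Y (i+1)),
      IsExactSeq (k+1) Y f ∧ Y 0 = reg R ∧ (∀ i, 1 ≤ i → i ≤ k+1 → MemAdd T (Y i)) ∧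
        (∀ i, 1 ≤ i → i ≤ k → MemAdd P (Y i))

/-- `M ∈ gen_k(X)`: there is an exact sequence `X^k → ⋯ → X^0 → M → 0` with `X^i ∈ add X`. -/
def MemGen (k : ℕ) (X M : ModuleCat.{0} R) : Prop :=
  ∃ (Y : ℕ → ModuleCat.{0} R) (f : ∀ i, Y i →ₗ[R] Y (i+1)),
    (∀ i, i ≤ k → MemAdd X (Y i)) ∧ Y (k+1) = M ∧
    Function.Surjective (f k) ∧ ∀ i, i < k → Function.Exact (f i) (f (i+1))

/-- `M ∈ cogen^k(X)`: there is an exact sequence `0 → M → X_0 → ⋯ → X_k` with `X_i ∈ add X`. -/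
def MemCogen (k : ℕ) (X M : ModuleCat.{0} R) : Prop :=
  ∃ (Y : ℕ → ModuleCat.{0} R) (f : ∀ i, Y i →ₗ[R] Y (i+1)),
    (∀ i, 1 ≤ i → i ≤ k+1 → MemAdd X (Y i)) ∧ Y 0 = M ∧
    Function.Injective (f 0) ∧ ∀ i, i < k → Function.Exact (f i) (f (i+1))

/-- `M ∈ gen_{k-1}(X)`, where `gen_{-1}(X)` is the whole module category. -/
def MemGenShift : ℕ → ModuleCat.{0} R → ModuleCat.{0} R → Prop
  | 0, _X, _M => True
  | (k+1), X, M => MemGen k X M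

/-- `M ∈ cogen^{k-1}(X)`, where `cogen^{-1}(X)` is the whole module category. -/
def MemCogenShift : ℕ → ModuleCat.{0} R → ModuleCat.{0} R → Prop
  | 0, _X, _M => True
  | (k+1), X, M => MemCogen k X M

/-- Global dimension at most `n` (on finitely generated modules). -/
def GldimLE (R : Type) [Ring R] (n : ℕ) : Prop :=
  ∀ M : ModuleCat.{0} R, Module.Finite R M → PdimLE n M

/-- Global dimension exactly `n`. -/
def GldimEq (R : Type) [Ring R] (n : ℕ) : Prop :=
  GldimLE R n ∧ ∀ m : ℕ, GldimLE R m → n ≤ m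

section Duality

variable (K : Type) [Field K]

section DualDefs
variable (S M : Type) [Semiring S] [AddCommGroup M] [Module K M]

/-- The action of `s : S` as a `K`-linear endomorphism. -/
def actMap [Module S M] [SMulCommClass S K M] (s : S) : M →ₗ[K] M where
  toFun m := s • m
  map_add' := smul_add s
  map_smul' c m := (smul_comm s c m)

/-- The `K`-linear dual of a left `S`-module is a left `Sᵐᵒᵖ`-module (i.e. a right
`S`-module), by precomposition. -/
def dualModuleOp [Module S M] [SMulCommClass S K M] : Module Sᵐᵒᵖ (M →ₗ[K] K) where
  smul s φ := φ ∘ₗ actMap K S M s.unop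
  one_smul φ := by ext m; exact congrArg φ (one_smul S m)
  mul_smul s t φ := by ext m; exact congrArg φ (mul_smul t.unop s.unop m)
  smul_zero s := by ext m; rfl
  smul_add s φ ψ := by ext m; rfl
  add_smul s t φ := by
    ext m
    show φ ((s.unop + t.unop) • m) = φ (s.unop • m) + φ (t.unop • m)
    rw [add_smul, map_add]
  zero_smul φ := by
    ext m
    show φ ((0 : S) • m) = 0
    rw [zero_smul, map_zero]

/-- The `K`-linear dual of a right `S`-module is a left `S`-module, by precomposition. -/
def dualModuleUnop [Module Sᵐᵒᵖ M] [SMulCommClass Sᵐᵒᵖ K M] : Module S (M →ₗ[K] K) where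
  smul s φ := φ ∘ₗ actMap K Sᵐᵒᵖ M (MulOpposite.op s)
  one_smul φ := by ext m; exact congrArg φ (one_smul Sᵐᵒᵖ m)
  mul_smul s t φ := by
    ext m
    show φ (MulOpposite.op (s * t) • m) = φ (MulOpposite.op t • MulOpposite.op s • m)
    rw [← mul_smul]
    rfl
  smul_zero s := by ext m; rfl
  smul_add s φ ψ := by ext m; rfl
  add_smul s t φ := by
    ext m
    show φ ((MulOpposite.op s + MulOpposite.op t) • m)
      = φ (MulOpposite.op s • m) + φ (MulOpposite.op t • m)
    rw [add_smul, map_add]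
  zero_smul φ := by
    ext m
    show φ ((0 : Sᵐᵒᵖ) • m) = 0
    rw [zero_smul, map_zero]

end DualDefs

/-- `D R`: the `K`-linear dual of the right regular module, as a left `R`-module. -/
def Dreg (R : Type) [Ring R] [Algebra K R] : ModuleCat.{0} R :=
  letI : Module R (R →ₗ[K] K) := dualModuleUnop K R R
  ModuleCat.of R (R →ₗ[K] K)

variable {R : Type} [Ring R] [Algebra K R]

/-- The `K`-module structure on an `R`-module, via restriction of scalars. -/
def kMod (M : ModuleCat.{0} R) : Module K M := Module.compHom M (algebraMap K R)

theorem kMod_smulCommClass (M : ModuleCat.{0} R) :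
    letI := kMod K M; SMulCommClass R K M := by
  letI := kMod K M
  constructor
  intro r c m
  show r • (algebraMap K R c • m) = algebraMap K R c • (r • m)
  rw [← mul_smul, ← mul_smul, Algebra.commutes]

theorem kMod_end_smulCommClass (M : ModuleCat.{0} R) :
    letI := kMod K M; SMulCommClass (Module.End R M) K M := by
  letI := kMod K M
  constructor
  intro f c m
  show f (algebraMap K R c • m) = algebraMap K R c • f m
  rw [map_smul]

/-- The dual `D T` of a left `R`-module `T`, as a left module over `B = End_R(T)ᵒᵖ`. -/
def DT (T : ModuleCat.{0} R) : ModuleCat.{0} ((Module.End R T)ᵐᵒᵖ) :=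
  letI := kMod K T
  letI := kMod_end_smulCommClass K T
  letI : Module (Module.End R T)ᵐᵒᵖ (T →ₗ[K] K) := dualModuleOp K (Module.End R T) T
  ModuleCat.of _ (T →ₗ[K] K)

/-- `C` is a `k`-cotilting module. -/
def IsCotilting (k : ℕ) (C : ModuleCat.{0} R) : Prop :=
  Module.Finite R C ∧ IdimLE k C ∧ ExtVanishing C C ∧
    ∃ (Y : ℕ → ModuleCat.{0} R) (f : ∀ i, Y i →ₗ[R] Y (i+1)),
      IsExactSeq (k+1) Y f ∧ Y (k+1) = Dreg K R ∧ ∀ i, i ≤ k → MemAdd C (Y i)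

/-- `C` is an `I`-special `k`-cotilting module: it is `k`-cotilting, and there is a resolution
`0 → c^k → ⋯ → c^0 → D R → 0` with all `c^j ∈ add C` and `c^j ∈ add I` for `j ≤ k-1`. -/
def IsSpecialCotilting (I : ModuleCat.{0} R) (k : ℕ) (C : ModuleCat.{0} R) : Prop :=
  IsCotilting K k C ∧
    ∃ (Y : ℕ → ModuleCat.{0} R) (f : ∀ i, Y i →ₗ[R] Y (i+1)),
      IsExactSeq (k+1) Y f ∧ Y (k+1) = Dreg K R ∧ (∀ i, i ≤ k → MemAdd C (Y i)) ∧
        (∀ i, 1 ≤ i → i ≤ k → MemAdd I (Y i))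

/-- `R` is a `d`-Auslander–Gorenstein algebra: `id R ≤ d+1 ≤ domdim R`. -/
def IsAuslanderGorenstein (R : Type) [Ring R] (d : ℕ) : Prop :=
  IdimLE (d+1) (reg R) ∧ DomdimGE R (d+1)

/-- `R` is a `d`-Auslander algebra: `gldim R ≤ d+1 ≤ domdim R`. -/
def IsAuslander (R : Type) [Ring R] (d : ℕ) : Prop :=
  GldimLE R (d+1) ∧ DomdimGE R (d+1)

end Duality

end PS
end

namespace PS

variable {R : Type} [Ring R]

/-- Vanishing of the Yoneda `Ext`-group `Ext^j(M, N)`. -/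
def ExtVan (M N : ModuleCat.{0} R) (j : ℕ) : Prop :=
  Subsingleton (Abelian.Ext.{0} M N j)

/-- There is a short exact sequence `0 → A → B → C → 0`. -/
structure IsShortExact {A B C : ModuleCat.{0} R} (f : A →ₗ[R] B) (g : B →ₗ[R] C) : Prop where
  inj : Function.Injective f
  exact : Function.Exact f g
  surj : Function.Surjective g

theorem extZero_succ_iff (M N : ModuleCat.{0} R) (j : ℕ) :
    ExtZero M N (j + 1) ↔ ExtVan M N (j + 1) := by
  let P := ProjectiveResolution.of M
  have h1 : ExtZero M N (j + 1) ↔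
      ∀ f : P.complex.X (j + 1) ⟶ N, P.complex.d (j + 2) (j + 1) ≫ f = 0 →
        ∃ g : P.complex.X j ⟶ N, P.complex.d (j + 1) j ≫ g = f := by
    have e := P.isoExt (R := ℤ) (j + 1) N
    have : ExtZero M N (j + 1) ↔
        Limits.IsZero ((P.complex.linearYonedaObj ℤ N).homology (j + 1)) := by
      rw [← e.isZero_iff, ModuleCat.isZero_iff_subsingleton]
      exact Iff.rfl
    rw [this, ← HomologicalComplex.exactAt_iff_isZero_homology,
      HomologicalComplex.exactAt_iff' _ j (j + 1) (j + 2) (by simp) (by simp),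
      ShortComplex.moduleCat_exact_iff]
    exact Iff.rfl
  rw [h1]
  constructor
  · intro h
    refine subsingleton_of_forall_eq 0 fun α => ?_
    obtain ⟨f, hf, rfl⟩ := P.extMk_surjective α (j + 2) rfl
    exact (P.extMk_eq_zero_iff f (j + 2) rfl hf j rfl).2 (h f hf)
  · intro h f hf
    exact (P.extMk_eq_zero_iff f (j + 2) rfl hf j rfl).1 (Subsingleton.elim (h := h) _ _)

theorem extVanishing_iff (M N : ModuleCat.{0} R) :
    ExtVanishing M N ↔ ∀ j, ExtVan M N (j + 1) := by
  refine ⟨fun h j => (extZero_succ_iff M N j).1 (h _ (by omega)), fun h j hj => ?_⟩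
  obtain ⟨i, rfl⟩ := Nat.exists_eq_add_of_le' hj
  exact (extZero_succ_iff M N i).2 (h i)

theorem extVan_of_projective (P N : ModuleCat.{0} R) [Module.Projective R P] (j : ℕ) :
    ExtVan P N (j + 1) :=
  haveI : Projective P := (IsProjective.iff_projective P).1 ‹_›
  Abelian.Ext.subsingleton_of_projective P N j

theorem extVan_of_injective (M I : ModuleCat.{0} R) [Module.Injective R I] (j : ℕ) :
    ExtVan M I (j + 1) :=
  haveI : Injective I := Module.injective_object_of_injective_module R I
  Abelian.Ext.subsingleton_of_injective M I j

theorem extVan_zero_iff (M N : ModuleCat.{0} R) :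
    ExtVan M N 0 ↔ ∀ f : M →ₗ[R] N, f = 0 := by
  unfold ExtVan
  rw [(Abelian.Ext.addEquiv₀ (X := M) (Y := N)).subsingleton_congr,
    (ModuleCat.homEquiv (M := M) (N := N)).subsingleton_congr]
  exact ⟨fun h f => Subsingleton.elim _ _, fun h => subsingleton_of_forall_eq 0 h⟩

section ShortExact

variable {A B C : ModuleCat.{0} R} {f : A →ₗ[R] B} {g : B →ₗ[R] C}

namespace IsShortExact

/-- The short complex of a short exact sequence of modules. -/
noncomputable abbrev complex (h : IsShortExact f g) : ShortComplex (ModuleCat.{0} R) :=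
  ShortComplex.mk (ModuleCat.ofHom f) (ModuleCat.ofHom g) (by
    ext x
    exact h.exact.apply_apply_eq_zero x)

theorem shortExact (h : IsShortExact f g) : h.complex.ShortExact where
  exact := (ShortComplex.ShortExact.moduleCat_exact_iff_function_exact _).2 h.exact
  mono_f := (ModuleCat.mono_iff_injective _).2 h.inj
  epi_g := (ModuleCat.epi_iff_surjective _).2 h.surj

theorem extVan_right (h : IsShortExact f g) {S : ModuleCat.{0} R} {j : ℕ}
    (hA : ExtVan S A (j + 1)) (hB : ExtVan S B j) : ExtVan S C j := by
  refine subsingleton_of_forall_eq 0 fun x => ?_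
  obtain ⟨y, rfl⟩ := Abelian.Ext.covariant_sequence_exact₃ S h.shortExact x rfl
    (Subsingleton.elim (h := hA) _ _)
  rw [Subsingleton.elim (h := hB) y 0, Abelian.Ext.zero_comp]

theorem extVan_left (h : IsShortExact f g) {S : ModuleCat.{0} R} {j : ℕ}
    (hC : ExtVan S C j) (hB : ExtVan S B (j + 1)) : ExtVan S A (j + 1) := by
  refine subsingleton_of_forall_eq 0 fun x => ?_
  obtain ⟨y, rfl⟩ := Abelian.Ext.covariant_sequence_exact₁ S h.shortExact x
    (Subsingleton.elim (h := hB) _ _) rfl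
  rw [Subsingleton.elim (h := hC) y 0, Abelian.Ext.zero_comp]

theorem extVan_left' (h : IsShortExact f g) {S : ModuleCat.{0} R} {j : ℕ}
    (hC : ExtVan C S (j + 1)) (hB : ExtVan B S j) : ExtVan A S j := by
  refine subsingleton_of_forall_eq 0 fun x => ?_
  obtain ⟨y, rfl⟩ := Abelian.Ext.contravariant_sequence_exact₁ h.shortExact S x (add_comm 1 j)
    (Subsingleton.elim (h := hC) _ _)
  rw [Subsingleton.elim (h := hB) y 0, Abelian.Ext.comp_zero]

theorem extVan_right' (h : IsShortExact f g) {S : ModuleCat.{0} R} {j : ℕ}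
    (hA : ExtVan A S j) (hB : ExtVan B S (j + 1)) : ExtVan C S (j + 1) := by
  refine subsingleton_of_forall_eq 0 fun x => ?_
  obtain ⟨y, rfl⟩ := Abelian.Ext.contravariant_sequence_exact₃ h.shortExact S x
    (Subsingleton.elim (h := hB) _ _) (add_comm 1 j)
  rw [Subsingleton.elim (h := hA) y 0, Abelian.Ext.comp_zero]

theorem exists_lift (h : IsShortExact f g) {S : ModuleCat.{0} R} (hA : ExtVan S A 1)
    (u : S →ₗ[R] C) : ∃ v : S →ₗ[R] B, g ∘ₗ v = u := by
  obtain ⟨y, hy⟩ := Abelian.Ext.covariant_sequence_exact₃ S h.shortExact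
    (Abelian.Ext.mk₀ (ModuleCat.ofHom u)) rfl (Subsingleton.elim (h := hA) _ _)
  obtain ⟨v, rfl⟩ := (Abelian.Ext.mk₀_bijective _ _).2 y
  rw [Abelian.Ext.mk₀_comp_mk₀] at hy
  exact ⟨v.hom, congrArg ModuleCat.Hom.hom ((Abelian.Ext.mk₀_bijective _ _).1 hy)⟩

theorem exists_extension (h : IsShortExact f g) {S : ModuleCat.{0} R} (hC : ExtVan C S 1)
    (u : A →ₗ[R] S) : ∃ v : B →ₗ[R] S, v ∘ₗ f = u := by
  obtain ⟨y, hy⟩ := Abelian.Ext.contravariant_sequence_exact₁ h.shortExact S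
    (Abelian.Ext.mk₀ (ModuleCat.ofHom u)) (add_comm 1 0) (Subsingleton.elim (h := hC) _ _)
  obtain ⟨v, rfl⟩ := (Abelian.Ext.mk₀_bijective _ _).2 y
  rw [Abelian.Ext.mk₀_comp_mk₀] at hy
  exact ⟨v.hom, congrArg ModuleCat.Hom.hom ((Abelian.Ext.mk₀_bijective _ _).1 hy)⟩

theorem extVan_one_of_lift (h : IsShortExact f g) {S : ModuleCat.{0} R} (hB : ExtVan S B 1)
    (hl : ∀ u : S →ₗ[R] C, ∃ v : S →ₗ[R] B, g ∘ₗ v = u) : ExtVan S A 1 := by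
  refine subsingleton_of_forall_eq 0 fun x => ?_
  obtain ⟨y, rfl⟩ := Abelian.Ext.covariant_sequence_exact₁ S h.shortExact x
    (Subsingleton.elim (h := hB) _ _) rfl
  obtain ⟨u, rfl⟩ := (Abelian.Ext.mk₀_bijective _ _).2 y
  obtain ⟨v, hv⟩ := hl u.hom
  obtain rfl : u = ModuleCat.ofHom v ≫ ModuleCat.ofHom g := by
    rw [← ModuleCat.ofHom_comp, hv]; rfl
  rw [← Abelian.Ext.mk₀_comp_mk₀, Abelian.Ext.comp_assoc_of_second_deg_zero]
  erw [h.shortExact.comp_extClass]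
  rw [Abelian.Ext.comp_zero]

theorem extVan_one_of_extension (h : IsShortExact f g) {S : ModuleCat.{0} R}
    (hB : ExtVan B S 1) (hl : ∀ u : A →ₗ[R] S, ∃ v : B →ₗ[R] S, v ∘ₗ f = u) :
    ExtVan C S 1 := by
  refine subsingleton_of_forall_eq 0 fun x => ?_
  obtain ⟨y, rfl⟩ := Abelian.Ext.contravariant_sequence_exact₃ h.shortExact S x
    (Subsingleton.elim (h := hB) _ _) (add_comm 1 0)
  obtain ⟨u, rfl⟩ := (Abelian.Ext.mk₀_bijective _ _).2 y
  obtain ⟨v, hv⟩ := hl u.hom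
  obtain rfl : u = ModuleCat.ofHom f ≫ ModuleCat.ofHom v := by
    rw [← ModuleCat.ofHom_comp, hv]; rfl
  rw [← Abelian.Ext.mk₀_comp_mk₀, ← Abelian.Ext.comp_assoc_of_second_deg_zero]
  erw [h.shortExact.extClass_comp]
  rw [Abelian.Ext.zero_comp]

end IsShortExact

end ShortExact

theorem isShortExact_range {A B : ModuleCat.{0} R} (f : A →ₗ[R] B) (hf : Function.Injective f) :
    IsShortExact (C := ModuleCat.of R (B ⧸ LinearMap.range f)) f (LinearMap.range f).mkQ :=
  ⟨hf, LinearMap.exact_map_mkQ_range f, Submodule.mkQ_surjective _⟩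

theorem isShortExact_ker {B C : ModuleCat.{0} R} (g : B →ₗ[R] C) (hg : Function.Surjective g) :
    IsShortExact (A := ModuleCat.of R (LinearMap.ker g)) (LinearMap.ker g).subtype g :=
  ⟨Submodule.injective_subtype _, LinearMap.exact_subtype_ker_map g, hg⟩

/-- A module `X` through which the identity of `M` factors as a finite sum. -/
theorem memAdd_iff {X M : ModuleCat.{0} R} :
    MemAdd X M ↔ ∃ (n : ℕ) (a : Fin n → (X →ₗ[R] M)) (b : Fin n → (M →ₗ[R] X)),
      ∀ m, ∑ i, a i (b i m) = m := by
  constructor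
  · rintro ⟨n, ι, π, h⟩
    refine ⟨n, fun i => π ∘ₗ LinearMap.single R (fun _ => (X : Type)) i,
      fun i => LinearMap.proj i ∘ₗ ι, fun m => ?_⟩
    have hm : ∑ i, LinearMap.single R (fun _ => (X : Type)) i ((ι m : Fin n → X) i) = ι m :=
      LinearMap.sum_single_apply _ _
    simp only [LinearMap.comp_apply, ← map_sum]
    exact (congrArg π hm).trans (LinearMap.congr_fun h m)
  · rintro ⟨n, a, b, h⟩
    refine ⟨n, LinearMap.pi b, ∑ i, a i ∘ₗ LinearMap.proj i, ?_⟩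
    ext m
    simpa using h m

theorem memAdd_of_sum {X M : ModuleCat.{0} R} {ι : Type} [Fintype ι]
    (a : ι → (X →ₗ[R] M)) (b : ι → (M →ₗ[R] X)) (h : ∀ m, ∑ i, a i (b i m) = m) :
    MemAdd X M := by
  let e := Fintype.equivFin ι
  refine memAdd_iff.2 ⟨Fintype.card ι, fun i => a (e.symm i), fun i => b (e.symm i), fun m => ?_⟩
  rw [e.symm.sum_comp (fun i => a i (b i m)), h]

theorem IsSummand.memAdd {X M : ModuleCat.{0} R} (h : IsSummand M X) : MemAdd X M := by
  obtain ⟨i, p, h⟩ := h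
  exact memAdd_of_sum (ι := Unit) (fun _ => p) (fun _ => i)
    (fun m => by simpa using LinearMap.congr_fun h m)

theorem IsSummand.refl (M : ModuleCat.{0} R) : IsSummand M M :=
  ⟨LinearMap.id, LinearMap.id, rfl⟩

theorem MemAdd.refl (X : ModuleCat.{0} R) : MemAdd X X := (IsSummand.refl X).memAdd

theorem IsSummand.trans {A B C : ModuleCat.{0} R} (h : IsSummand A B) (h' : IsSummand B C) :
    IsSummand A C := by
  obtain ⟨i, p, h⟩ := h
  obtain ⟨i', p', h'⟩ := h'
  refine ⟨i' ∘ₗ i, p ∘ₗ p', ?_⟩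
  rw [LinearMap.comp_assoc, ← LinearMap.comp_assoc i i' p', h', LinearMap.id_comp, h]

theorem MemAdd.trans {X Y Z : ModuleCat.{0} R} (h : MemAdd X Y) (h' : MemAdd Y Z) :
    MemAdd X Z := by
  obtain ⟨n, a, b, h⟩ := memAdd_iff.1 h
  obtain ⟨n', a', b', h'⟩ := memAdd_iff.1 h'
  refine memAdd_of_sum (ι := Fin n' × Fin n) (fun i => a' i.1 ∘ₗ a i.2)
    (fun i => b i.2 ∘ₗ b' i.1) fun m => ?_
  rw [Fintype.sum_prod_type]
  simp only [LinearMap.comp_apply, ← map_sum, h, h']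

theorem isSummand_prod_left (A B : ModuleCat.{0} R) : IsSummand A (ModuleCat.of R (A × B)) :=
  ⟨LinearMap.inl R A B, LinearMap.fst R A B, rfl⟩

theorem isSummand_prod_right (A B : ModuleCat.{0} R) : IsSummand B (ModuleCat.of R (A × B)) :=
  ⟨LinearMap.inr R A B, LinearMap.snd R A B, rfl⟩

theorem MemAdd.prod {X A B : ModuleCat.{0} R} (hA : MemAdd X A) (hB : MemAdd X B) :
    MemAdd X (ModuleCat.of R (A × B)) := by
  obtain ⟨n, a, b, h⟩ := memAdd_iff.1 hA
  obtain ⟨n', a', b', h'⟩ := memAdd_iff.1 hB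
  refine memAdd_of_sum (ι := Fin n ⊕ Fin n')
    (Sum.elim (fun i => LinearMap.inl R A B ∘ₗ a i) (fun i => LinearMap.inr R A B ∘ₗ a' i))
    (Sum.elim (fun i => b i ∘ₗ LinearMap.fst R A B) (fun i => b' i ∘ₗ LinearMap.snd R A B))
    fun m => ?_
  obtain ⟨x, y⟩ := m
  rw [Fintype.sum_sum_type]
  simp only [Sum.elim_inl, Sum.elim_inr, LinearMap.comp_apply, ← map_sum]
  erw [h, h']
  simp

theorem memAdd_pi (X : ModuleCat.{0} R) (n : ℕ) : MemAdd X (ModuleCat.of R (Fin n → X)) :=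
  ⟨n, IsSummand.refl _⟩

theorem IsSummand.of_equiv {A B : ModuleCat.{0} R} (e : A ≃ₗ[R] B) : IsSummand A B :=
  ⟨e, e.symm, by ext; simp⟩

theorem MemAdd.of_subsingleton (X A : ModuleCat.{0} R) [Subsingleton A] : MemAdd X A :=
  memAdd_of_sum (ι := Empty) (fun i => i.elim) (fun i => i.elim) fun _ => Subsingleton.elim _ _

theorem MemAdd.projective {X A : ModuleCat.{0} R} (h : MemAdd X A) [Module.Projective R X] :
    Module.Projective R A := by
  obtain ⟨n, i, p, h⟩ := h
  have : Module.Projective R (Fin n → X) :=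
    Module.Projective.of_equiv (DFinsupp.linearEquivFunOnFintype (R := R) (M := fun _ : Fin n => X))
  exact Module.Projective.of_split (P := A) (M := Fin n → X) i p h

theorem IsSummand.injective {X A : ModuleCat.{0} R} (h : IsSummand A X) [Module.Injective R X] :
    Module.Injective R A := by
  obtain ⟨i, p, h⟩ := h
  refine ⟨fun U V _ _ _ _ f hf g => ?_⟩
  obtain ⟨v, hv⟩ := Module.Injective.out f hf (i ∘ₗ g)
  exact ⟨p ∘ₗ v, fun x => (congrArg p (hv x)).trans (LinearMap.congr_fun h (g x))⟩

theorem MemAdd.injective {X A : ModuleCat.{0} R} (h : MemAdd X A) [Module.Injective R X] :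
    Module.Injective R A := by
  obtain ⟨n, h⟩ := h
  have : Module.Injective R (Fin n → X) := inferInstance
  exact h.injective

theorem MemAdd.finite {X A : ModuleCat.{0} R} (h : MemAdd X A) [Module.Finite R X] :
    Module.Finite R A := by
  obtain ⟨n, i, p, h⟩ := h
  exact Module.Finite.of_surjective p fun x => ⟨i x, LinearMap.congr_fun h x⟩

theorem MemAdd.extVan_left {X A S : ModuleCat.{0} R} {j : ℕ} (h : MemAdd X A)
    (hX : ExtVan X S j) : ExtVan A S j := by
  obtain ⟨n, a, b, h⟩ := memAdd_iff.1 h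
  refine subsingleton_of_forall_eq 0 fun x => ?_
  have hid : 𝟙 A = ∑ i, ModuleCat.ofHom (b i) ≫ ModuleCat.ofHom (a i) := by
    ext m
    simp only [ModuleCat.hom_sum, ModuleCat.hom_comp, LinearMap.sum_apply, LinearMap.comp_apply]
    exact (h m).symm
  rw [← Abelian.Ext.mk₀_id_comp x, hid, Abelian.Ext.mk₀_sum, Abelian.Ext.sum_comp]
  refine Finset.sum_eq_zero fun i _ => ?_
  rw [← Abelian.Ext.mk₀_comp_mk₀_assoc, Subsingleton.elim (h := hX) (Abelian.Ext.comp _ x _) 0,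
    Abelian.Ext.comp_zero]

theorem MemAdd.extVan_right {X A S : ModuleCat.{0} R} {j : ℕ} (h : MemAdd X A)
    (hX : ExtVan S X j) : ExtVan S A j := by
  obtain ⟨n, a, b, h⟩ := memAdd_iff.1 h
  refine subsingleton_of_forall_eq 0 fun x => ?_
  have hid : 𝟙 A = ∑ i, ModuleCat.ofHom (b i) ≫ ModuleCat.ofHom (a i) := by
    ext m
    simp only [ModuleCat.hom_sum, ModuleCat.hom_comp, LinearMap.sum_apply, LinearMap.comp_apply]
    exact (h m).symm
  rw [← Abelian.Ext.comp_mk₀_id x, hid, Abelian.Ext.mk₀_sum, Abelian.Ext.comp_sum]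
  refine Finset.sum_eq_zero fun i _ => ?_
  rw [← Abelian.Ext.mk₀_comp_mk₀, ← Abelian.Ext.comp_assoc_of_third_deg_zero,
    Subsingleton.elim (h := hX) (Abelian.Ext.comp x _ _) 0, Abelian.Ext.zero_comp]

/-- `Chain P k M N`: there is an exact sequence `0 → M → Y₁ → ⋯ → Yₖ → N → 0` all of whose
middle terms satisfy `P`. -/
inductive Chain (P : ModuleCat.{0} R → Prop) : ℕ → ModuleCat.{0} R → ModuleCat.{0} R → Prop
  | nil {M N : ModuleCat.{0} R} (e : M ≃ₗ[R] N) : Chain P 0 M N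
  | cons {k : ℕ} {M Y M' N : ModuleCat.{0} R} {f : M →ₗ[R] Y} {g : Y →ₗ[R] M'}
      (h : IsShortExact f g) (hY : P Y) (c : Chain P k M' N) : Chain P (k + 1) M N

namespace Chain

variable {P Q : ModuleCat.{0} R → Prop} {k : ℕ} {M N S : ModuleCat.{0} R}

theorem mono (c : Chain P k M N) (h : ∀ Y, P Y → Q Y) : Chain Q k M N := by
  induction c with
  | nil e => exact nil e
  | cons hs hY _ ih => exact cons hs (h _ hY) ih

theorem equiv_left (c : Chain P k M N) {L : ModuleCat.{0} R} (e : L ≃ₗ[R] M) :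
    Chain P k L N := by
  cases c with
  | nil e' => exact nil (e.trans e')
  | @cons k _ Y M' _ f g h hY c =>
    refine cons (f := f ∘ₗ e.toLinearMap) (g := g) ⟨?_, ?_, h.surj⟩ hY c
    · exact h.inj.comp e.injective
    · intro y
      rw [h.exact y]
      constructor
      · rintro ⟨x, rfl⟩
        exact ⟨e.symm x, by simp⟩
      · rintro ⟨x, rfl⟩
        exact ⟨e x, rfl⟩

theorem snoc (c : Chain P k M N) {Y N' : ModuleCat.{0} R} {f : N →ₗ[R] Y} {g : Y →ₗ[R] N'}
    (h : IsShortExact f g) (hY : P Y) : Chain P (k + 1) M N' := by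
  induction c with
  | nil e => exact (cons h hY (nil (LinearEquiv.refl R N'))).equiv_left e
  | cons hs hY' _ ih => exact cons hs hY' (ih h)

theorem finite (c : Chain P k M N) (hP : ∀ Y, P Y → Module.Finite R Y)
    (hM : Module.Finite R M) : Module.Finite R N := by
  induction c with
  | nil e => exact Module.Finite.equiv e
  | cons hs hY _ ih =>
    have := hP _ hY
    exact ih (Module.Finite.of_surjective _ hs.surj)

theorem extVan_start (c : Chain P k M N) (hP : ∀ Y, P Y → ∀ j, ExtVan S Y (j + 1)) (j : ℕ)
    (h : ExtVan S N (j + 1)) : ExtVan S M (j + 1 + k) := by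
  induction c with
  | nil e => exact (IsSummand.of_equiv e).memAdd.extVan_right h
  | cons hs hY _ ih => exact hs.extVan_left (ih h) (hP _ hY _)

theorem extVan_end (c : Chain P k M N) (hP : ∀ Y, P Y → ∀ j, ExtVan S Y (j + 1)) (j : ℕ)
    (h : ExtVan S M (j + 1 + k)) : ExtVan S N (j + 1) := by
  induction c with
  | nil e => exact (IsSummand.of_equiv e.symm).memAdd.extVan_right h
  | @cons k _ Y M' _ f g hs hY _ ih =>
    have : ExtVan S Y (j + 1 + k) := by
      rw [Nat.add_right_comm]
      exact hP _ hY _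
    exact ih (hs.extVan_right h this)

theorem extVan_end' (c : Chain P k M N) (hP : ∀ Y, P Y → ∀ j, ExtVan Y S (j + 1)) (j : ℕ)
    (h : ExtVan M S (j + 1)) : ExtVan N S (j + 1 + k) := by
  induction c generalizing j with
  | nil e => exact (IsSummand.of_equiv e.symm).memAdd.extVan_left h
  | @cons k _ Y M' _ f g hs hY _ ih =>
    have := ih (j + 1) (hs.extVan_right' h (hP _ hY _))
    rwa [Nat.add_right_comm] at this

theorem extVan_start' (c : Chain P k M N) (hP : ∀ Y, P Y → ∀ j, ExtVan Y S (j + 1)) (j : ℕ)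
    (h : ExtVan N S (j + 1 + k)) : ExtVan M S (j + 1) := by
  induction c generalizing j with
  | nil e => exact (IsSummand.of_equiv e).memAdd.extVan_left h
  | @cons k _ Y M' _ f g hs hY _ ih =>
    refine hs.extVan_left' (ih (j + 1) ?_) (hP _ hY _)
    rwa [Nat.add_right_comm]

/-- If `S` maps trivially to the middle terms, all of them injective, then the lower
extension groups from `S` to the left end vanish. -/
theorem extVan_of_hom_eq_zero (c : Chain P k M N)
    (hP : ∀ Y, P Y → ∀ j, ExtVan S Y j) (j : ℕ) (hj : j < k) : ExtVan S M j := by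
  induction c generalizing j with
  | nil e => omega
  | @cons k _ Y M' _ f g hs hY _ ih =>
    cases j with
    | zero =>
      rw [extVan_zero_iff]
      intro u
      have h0 := (extVan_zero_iff S Y).1 (hP _ hY 0) (f ∘ₗ u)
      ext x
      apply hs.inj
      simpa using LinearMap.congr_fun h0 x
    | succ j => exact hs.extVan_left (ih j (by omega)) (hP _ hY _)

theorem exists_seq (c : Chain P k M N) :
    ∃ (Y : ℕ → ModuleCat.{0} R) (f : ∀ i, Y i →ₗ[R] Y (i + 1)),
      IsExactSeq (k + 1) Y f ∧ Y 0 = M ∧ Y (k + 1) = N ∧ ∀ i, 1 ≤ i → i ≤ k → P (Y i) := by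
  induction c with
  | @nil M N e =>
    let Y : ℕ → ModuleCat.{0} R := fun i =>
      match i with
      | 0 => M
      | _ + 1 => N
    let f : ∀ i, Y i →ₗ[R] Y (i + 1) := fun i =>
      match i with
      | 0 => e.toLinearMap
      | i + 1 => (LinearMap.id : N →ₗ[R] N)
    exact ⟨Y, f, ⟨e.injective, e.surjective, fun i hi => by omega⟩, rfl, rfl,
      fun i h1 h2 => by omega⟩
  | @cons k M Z M' N u v hs hZ _ ih =>
    obtain ⟨Y, f, hf, rfl, rfl, hP⟩ := ih
    let Y' : ℕ → ModuleCat.{0} R := fun i =>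
      match i with
      | 0 => M
      | 1 => Z
      | i + 2 => Y (i + 1)
    let f' : ∀ i, Y' i →ₗ[R] Y' (i + 1) := fun i =>
      match i with
      | 0 => u
      | 1 => f 0 ∘ₗ v
      | i + 2 => f (i + 1)
    refine ⟨Y', f', ⟨hs.inj, ?_, ?_⟩, rfl, rfl, ?_⟩
    · have := hf.2.1
      cases k with
      | zero => exact this.comp hs.surj
      | succ k => exact this
    · intro i hi
      match i with
      | 0 => exact hs.exact.comp_injective (f 0) hf.1 (map_zero (f 0))
      | 1 =>
        intro y
        rw [hf.2.2 0 (by omega) y]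
        constructor
        · rintro ⟨x, rfl⟩
          obtain ⟨z, rfl⟩ := hs.surj x
          exact ⟨z, rfl⟩
        · rintro ⟨z, rfl⟩
          exact ⟨v z, rfl⟩
      | i + 2 => exact hf.2.2 (i + 1) (by omega)
    · intro i h1 h2
      match i with
      | 1 => exact hZ
      | i + 2 => exact hP (i + 1) (by omega) (by omega)

theorem of_maps (k : ℕ) (M : ModuleCat.{0} R) (Y : ℕ → ModuleCat.{0} R) (g : M →ₗ[R] Y 0)
    (f : ∀ i, Y i →ₗ[R] Y (i + 1)) (hg : Function.Injective g)
    (hgs : k = 0 → Function.Surjective g) (hfs : ∀ i, i + 1 = k → Function.Surjective (f i))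
    (hgf : 1 ≤ k → Function.Exact g (f 0))
    (hff : ∀ i, i + 2 ≤ k → Function.Exact (f i) (f (i + 1))) (hP : ∀ i, i < k → P (Y i)) :
    Chain P k M (Y k) := by
  induction k generalizing M Y with
  | zero => exact nil (LinearEquiv.ofBijective g ⟨hg, hgs rfl⟩)
  | succ k ih =>
    have hgf := hgf (by omega)
    have hle : LinearMap.range g ≤ LinearMap.ker (f 0) := (LinearMap.exact_iff.1 hgf).ge
    have hk : ∀ x, (LinearMap.range g).liftQ (f 0) hle ((LinearMap.range g).mkQ x) = f 0 x :=
      fun x => rfl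
    refine cons (isShortExact_range g hg) (hP 0 (by omega))
      (ih (ModuleCat.of R (Y 0 ⧸ LinearMap.range g)) (fun i => Y (i + 1))
        ((LinearMap.range g).liftQ (f 0) hle) (fun i => f (i + 1)) ?_ ?_ ?_ ?_ ?_ ?_)
    · rw [← LinearMap.ker_eq_bot]
      exact Submodule.ker_liftQ_eq_bot _ _ _ (LinearMap.exact_iff.1 hgf).le
    · rintro rfl y
      obtain ⟨x, rfl⟩ := hfs 0 rfl y
      exact ⟨(LinearMap.range g).mkQ x, rfl⟩
    · intro i hi
      exact hfs (i + 1) (by omega)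
    · intro h1 y
      rw [hff 0 (by omega) y]
      constructor
      · rintro ⟨x, rfl⟩
        exact ⟨(LinearMap.range g).mkQ x, rfl⟩
      · rintro ⟨x, rfl⟩
        obtain ⟨x, rfl⟩ := Submodule.mkQ_surjective _ x
        exact ⟨x, rfl⟩
    · intro i hi
      exact hff (i + 1) (by omega)
    · intro i hi
      exact hP (i + 1) (by omega)

theorem of_isExactSeq {Y : ℕ → ModuleCat.{0} R} {f : ∀ i, Y i →ₗ[R] Y (i + 1)}
    (h : IsExactSeq (k + 1) Y f) (hP : ∀ i, 1 ≤ i → i ≤ k → P (Y i)) :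
    Chain P k (Y 0) (Y (k + 1)) := by
  refine of_maps k (Y 0) (fun i => Y (i + 1)) (f 0) (fun i => f (i + 1)) h.1 ?_ ?_ ?_ ?_ ?_
  · rintro rfl
    exact h.2.1
  · rintro i rfl
    exact h.2.1
  · intro hk
    exact h.2.2 0 (by omega)
  · intro i hi
    exact h.2.2 (i + 1) (by omega)
  · intro i hi
    exact hP (i + 1) (by omega) (by omega)

theorem of_coresolution (k : ℕ) (M : ModuleCat.{0} R) (Y : ℕ → ModuleCat.{0} R)
    (g : M →ₗ[R] Y 0) (f : ∀ i, Y i →ₗ[R] Y (i + 1)) (hg : Function.Injective g)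
    (hgf : Function.Exact g (f 0)) (hff : ∀ i, Function.Exact (f i) (f (i + 1)))
    (hP : ∀ i, i < k → P (Y i)) : ∃ N, Chain P k M N := by
  induction k generalizing M Y with
  | zero => exact ⟨M, nil (LinearEquiv.refl R M)⟩
  | succ k ih =>
    have hle : LinearMap.range g ≤ LinearMap.ker (f 0) := (LinearMap.exact_iff.1 hgf).ge
    obtain ⟨N, c⟩ := ih (ModuleCat.of R (Y 0 ⧸ LinearMap.range g)) (fun i => Y (i + 1))
      ((LinearMap.range g).liftQ (f 0) hle) (fun i => f (i + 1))
      (by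
        rw [← LinearMap.ker_eq_bot]
        exact Submodule.ker_liftQ_eq_bot _ _ _ (LinearMap.exact_iff.1 hgf).le)
      (by
        intro y
        rw [hff 0 y]
        constructor
        · rintro ⟨x, rfl⟩
          exact ⟨(LinearMap.range g).mkQ x, rfl⟩
        · rintro ⟨x, rfl⟩
          obtain ⟨x, rfl⟩ := Submodule.mkQ_surjective _ x
          exact ⟨x, rfl⟩)
      (fun i => hff (i + 1)) (fun i hi => hP (i + 1) (by omega))
    exact ⟨N, cons (isShortExact_range g hg) (hP 0 (by omega)) c⟩

end Chain

section HomologicalDimension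

variable {M : ModuleCat.{0} R} {k : ℕ}

theorem PdimLE.extVan (h : PdimLE k M) (S : ModuleCat.{0} R) (j : ℕ) :
    ExtVan M S (j + 1 + k) := by
  obtain ⟨Y, f, hf, hP, rfl⟩ := h
  have := hP 0 (Nat.zero_le _)
  refine (Chain.of_isExactSeq (P := fun Y => Module.Projective R Y) hf
    fun i _ hi => hP i hi).extVan_end' ?_ j (extVan_of_projective _ _ _)
  intro Y hY j
  exact extVan_of_projective _ _ _

theorem IdimLE.extVan (h : IdimLE k M) (S : ModuleCat.{0} R) (j : ℕ) :
    ExtVan S M (j + 1 + k) := by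
  obtain ⟨Y, f, hf, hP, rfl⟩ := h
  have := hP (k + 1) (by omega) le_rfl
  refine (Chain.of_isExactSeq (P := fun Y => Module.Injective R Y) hf
    fun i h1 hi => hP i h1 (by omega)).extVan_start ?_ j (extVan_of_injective _ _ _)
  intro Y hY j
  exact extVan_of_injective _ _ _

theorem exists_projective_chain (k : ℕ) (M : ModuleCat.{0} R)
    (h : ∀ S, ExtVan M S (k + 1)) :
    ∃ N : ModuleCat.{0} R, Module.Projective R N ∧
      Chain (fun Y => Module.Projective R Y) k N M := by
  have hs := isShortExact_ker (B := ModuleCat.of R (M →₀ R)) (C := M)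
    (Finsupp.linearCombination R (id : M → M)) (Finsupp.linearCombination_id_surjective R M)
  have hF : Module.Projective R (ModuleCat.of R (M →₀ R)) :=
    inferInstanceAs (Module.Projective R (M →₀ R))
  induction k generalizing M with
  | zero =>
    obtain ⟨v, hv⟩ := hs.exists_lift (h _) LinearMap.id
    exact ⟨M, Module.Projective.of_split v _ hv, Chain.nil (LinearEquiv.refl R M)⟩
  | succ k ih =>
    obtain ⟨N, hN, c⟩ := ih _ (fun S => hs.extVan_left' (h S) (extVan_of_projective _ _ _))
      (isShortExact_ker _ (Finsupp.linearCombination_id_surjective R _))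
      (inferInstanceAs (Module.Projective R (_ →₀ R)))
    exact ⟨N, hN, c.snoc hs hF⟩

theorem exists_injective_embedding (M : ModuleCat.{0} R) :
    ∃ (I : ModuleCat.{0} R) (i : M →ₗ[R] I), Module.Injective R I ∧ Function.Injective i := by
  let I : ModuleCat.{0} R := Injective.under M
  have : Injective I := inferInstanceAs (Injective (Injective.under M))
  exact ⟨I, (Injective.ι M).hom, Module.injective_module_of_injective_object R I,
    (ModuleCat.mono_iff_injective (Injective.ι M)).1 inferInstance⟩

theorem exists_injective_chain (k : ℕ) (M : ModuleCat.{0} R)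
    (h : ∀ S, ExtVan S M (k + 1)) :
    ∃ N : ModuleCat.{0} R, Module.Injective R N ∧
      Chain (fun Y => Module.Injective R Y) k M N := by
  induction k generalizing M with
  | zero =>
    obtain ⟨I, i, hI, hi⟩ := exists_injective_embedding M
    obtain ⟨v, hv⟩ := (isShortExact_range _ hi).exists_extension (h _) LinearMap.id
    exact ⟨M, IsSummand.injective ⟨_, v, hv⟩, Chain.nil (LinearEquiv.refl R M)⟩
  | succ k ih =>
    obtain ⟨I, i, hI, hi⟩ := exists_injective_embedding M
    have hs := isShortExact_range _ hi
    obtain ⟨N, hN, c⟩ := ih _ (fun S => hs.extVan_right (h S) (extVan_of_injective _ _ _))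
    exact ⟨N, hN, Chain.cons hs hI c⟩

theorem pdimLE_of_extVan (h : ∀ S, ExtVan M S (k + 1)) : PdimLE k M := by
  obtain ⟨N, hN, c⟩ := exists_projective_chain k M h
  obtain ⟨Y, f, hf, rfl, rfl, hP⟩ := c.exists_seq
  refine ⟨Y, f, hf, fun i hi => ?_, rfl⟩
  rcases Nat.eq_zero_or_pos i with rfl | h0
  · exact hN
  · exact hP i h0 hi

theorem idimLE_of_extVan (h : ∀ S, ExtVan S M (k + 1)) : IdimLE k M := by
  obtain ⟨N, hN, c⟩ := exists_injective_chain k M h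
  obtain ⟨Y, f, hf, rfl, rfl, hP⟩ := c.exists_seq
  refine ⟨Y, f, hf, fun i h1 hi => ?_, rfl⟩
  rcases Nat.lt_or_ge k i with h0 | h0
  · obtain rfl : i = k + 1 := by omega
    exact hN
  · exact hP i h1 h0

end HomologicalDimension

theorem IsSummand.finite {A M : ModuleCat.{0} R} (h : IsSummand A M) [Module.Finite R M] :
    Module.Finite R A := h.memAdd.finite

theorem IsSummand.prod {A B C D : ModuleCat.{0} R} (h : IsSummand A C) (h' : IsSummand B D) :
    IsSummand (ModuleCat.of R (A × B)) (ModuleCat.of R (C × D)) := by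
  obtain ⟨i, p, h⟩ := h
  obtain ⟨i', p', h'⟩ := h'
  refine ⟨i.prodMap i', p.prodMap p', ?_⟩
  refine LinearMap.ext fun x => Prod.ext ?_ ?_
  · exact LinearMap.congr_fun h x.1
  · exact LinearMap.congr_fun h' x.2

/-- A direct summand has a complement. -/
theorem IsSummand.exists_equiv_prod {A M : ModuleCat.{0} R} (h : IsSummand A M) :
    ∃ B : ModuleCat.{0} R, Nonempty (M ≃ₗ[R] (A × B)) := by
  obtain ⟨i, p, h⟩ := h
  have hp : ∀ a, p (i a) = a := LinearMap.congr_fun h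
  let q : M →ₗ[R] LinearMap.ker p :=
    (LinearMap.id - i ∘ₗ p).codRestrict _ fun m => by simp [hp]
  refine ⟨ModuleCat.of R (LinearMap.ker p), ⟨LinearEquiv.ofLinearMap (p.prod q)
    (i.coprod (LinearMap.ker p).subtype) ?_ ?_⟩⟩
  · refine LinearMap.ext fun x => Prod.ext ?_ (Subtype.ext ?_)
    · have : p x.2.1 = 0 := x.2.2
      simp [hp, this]
    · have : p x.2.1 = 0 := x.2.2
      simp [q, hp, this]
  · ext m
    simp [q]

theorem isSummand_of_isCompl {M : ModuleCat.{0} R} {p q : Submodule R M} (h : IsCompl p q) :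
    IsSummand (ModuleCat.of R p) M :=
  ⟨p.subtype, p.projectionOnto q h, by ext x; simp⟩

section Local

theorem isSummand_of_isUnit {A X : ModuleCat.{0} R} (a : X →ₗ[R] A) (b : A →ₗ[R] X)
    (h : IsUnit (a ∘ₗ b : Module.End R A)) : IsSummand A X := by
  obtain ⟨u, hu⟩ := h
  refine ⟨b, (u⁻¹ : (Module.End R A)ˣ).1 ∘ₗ a, ?_⟩
  rw [LinearMap.comp_assoc, ← hu]
  exact u.inv_mul

/-- A module with local endomorphism ring that is a summand of a finite direct sum is a summand
of one of the terms. -/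
theorem exists_isSummand_of_sum {A : ModuleCat.{0} R} [IsLocalRing (Module.End R A)]
    {ι : Type} [Fintype ι] (X : ι → ModuleCat.{0} R) (a : ∀ i, X i →ₗ[R] A)
    (b : ∀ i, A →ₗ[R] X i) (h : ∀ m, ∑ i, a i (b i m) = m) : ∃ i, IsSummand A (X i) := by
  have hs : IsUnit (∑ i, (a i ∘ₗ b i : Module.End R A)) := by
    convert isUnit_one
    ext m
    simpa using h m
  obtain ⟨i, -, hi⟩ := IsLocalRing.exists_of_isUnit_sum hs
  exact ⟨i, isSummand_of_isUnit _ _ hi⟩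

theorem MemAdd.isSummand {A X : ModuleCat.{0} R} [IsLocalRing (Module.End R A)]
    (h : MemAdd X A) : IsSummand A X := by
  obtain ⟨n, a, b, h⟩ := memAdd_iff.1 h
  obtain ⟨_, h⟩ := exists_isSummand_of_sum (fun _ => X) a b h
  exact h

theorem IsSummand.of_prod {A X Y : ModuleCat.{0} R} [IsLocalRing (Module.End R A)]
    (h : IsSummand A (ModuleCat.of R (X × Y))) : IsSummand A X ∨ IsSummand A Y := by
  obtain ⟨i, p, h⟩ := h
  obtain ⟨j, hj⟩ := exists_isSummand_of_sum (A := A) (fun b : Bool => if b then X else Y)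
    (fun b => match b with
      | true => p ∘ₗ LinearMap.inl R X Y
      | false => p ∘ₗ LinearMap.inr R X Y)
    (fun b => match b with
      | true => LinearMap.fst R X Y ∘ₗ i
      | false => LinearMap.snd R X Y ∘ₗ i) (fun m => by
      rw [Fintype.sum_bool]
      refine Eq.trans ?_ (LinearMap.congr_fun h m)
      refine (map_add p _ _).symm.trans (congrArg p ?_)
      exact Prod.ext (add_zero _) (zero_add _))
  cases j
  · exact Or.inr hj
  · exact Or.inl hj

theorem nontrivial_of_isLocalRing_end (A : ModuleCat.{0} R) [IsLocalRing (Module.End R A)] :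
    Nontrivial A := by
  by_contra h
  rw [not_nontrivial_iff_subsingleton] at h
  exact zero_ne_one (α := Module.End R A) (LinearMap.ext fun _ => Subsingleton.elim _ _)

end Local

section FiniteLength

variable [IsArtinianRing R]

theorem exists_isLocalRing_isSummand (M : ModuleCat.{0} R) [Module.Finite R M] [Nontrivial M] :
    ∃ A : ModuleCat.{0} R, IsSummand A M ∧ IsLocalRing (Module.End R A) := by
  obtain ⟨A, ⟨hA, hA'⟩, hmin⟩ := (InvImage.wf (fun A : ModuleCat.{0} R => Module.length R A)
    wellFounded_lt).has_min {A | IsSummand A M ∧ Nontrivial A} ⟨M, IsSummand.refl M, ‹_›⟩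
  have := hA.finite
  refine ⟨A, hA, IsLocalRing.of_isUnit_or_isUnit_one_sub_self fun f => ?_⟩
  obtain ⟨n, hn⟩ := Filter.eventually_atTop.1 (LinearMap.eventually_isCompl_ker_pow_range_pow f)
  have hc := hn (n + 1) (by omega)
  by_cases hb : LinearMap.ker (f ^ (n + 1)) = ⊥
  · left
    rw [Module.End.isUnit_iff]
    refine IsArtinian.bijective_of_injective_endomorphism f ?_
    have := LinearMap.ker_eq_bot.1 hb
    rw [pow_succ] at this
    exact Function.Injective.of_comp (f := (f ^ n : Module.End R A)) this
  · right
    refine IsNilpotent.isUnit_one_sub ⟨n + 1, ?_⟩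
    by_contra h0
    have ht : LinearMap.ker (f ^ (n + 1)) < ⊤ :=
      lt_top_iff_ne_top.2 fun h => h0 (LinearMap.ker_eq_top.1 h)
    exact hmin (ModuleCat.of R (LinearMap.ker (f ^ (n + 1))))
      ⟨(isSummand_of_isCompl hc).trans hA, Submodule.nontrivial_iff_ne_bot.2 hb⟩
      (Submodule.length_lt ht.ne)

theorem length_lt_prod {A B : ModuleCat.{0} R} [Module.Finite R B] [Nontrivial A] :
    Module.length R B < Module.length R (A × B) := by
  rw [Module.length_prod, add_comm]
  exact ((ENat.lt_add_one_iff Module.length_ne_top).2 le_rfl).trans_le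
    (add_le_add_right (Order.one_le_iff_pos.2 Module.length_pos) _)

/-- A basic module in `add X` is a summand of `X`. -/
theorem IsBasic.isSummand {M X : ModuleCat.{0} R} [Module.Finite R M]
    (hM : IsBasic M) (h : MemAdd X M) : IsSummand M X := by
  obtain ⟨B, ⟨A, Y, ⟨e⟩, ⟨e'⟩⟩, hmin⟩ :=
    (InvImage.wf (fun A : ModuleCat.{0} R => Module.length R A) wellFounded_lt).has_min
      {B | ∃ A Y : ModuleCat.{0} R, Nonempty (M ≃ₗ[R] (A × B)) ∧ Nonempty (X ≃ₗ[R] (A × Y))}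
      ⟨M, ModuleCat.of R PUnit, X,
        ⟨(LinearEquiv.uniqueProd (M₂ := PUnit.{1})).symm⟩,
        ⟨(LinearEquiv.uniqueProd (M₂ := PUnit.{1})).symm⟩⟩
  have hX : IsSummand A X :=
    (isSummand_prod_left A Y).trans (IsSummand.of_equiv (A := ModuleCat.of R (A × Y)) e'.symm)
  have hBM : IsSummand B M :=
    (isSummand_prod_right A B).trans (IsSummand.of_equiv (A := ModuleCat.of R (A × B)) e.symm)
  have := hBM.finite
  rcases subsingleton_or_nontrivial B with hB | hB
  · have : Unique B := uniqueOfSubsingleton 0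
    exact (IsSummand.of_equiv (e.trans LinearEquiv.prodUnique)).trans hX
  · obtain ⟨L, hLB, hL⟩ := exists_isLocalRing_isSummand B
    have hLX : IsSummand L (ModuleCat.of R (A × Y)) :=
      (h.trans (hLB.trans hBM).memAdd).isSummand.trans (IsSummand.of_equiv e')
    have hLn := nontrivial_of_isLocalRing_end L
    exfalso
    rcases hLX.of_prod with hLA | hLY
    · have := hM L ((hLA.prod hLB).trans
        (IsSummand.of_equiv (A := ModuleCat.of R (A × B)) e.symm))
      exact not_subsingleton L this
    · obtain ⟨B', ⟨eB⟩⟩ := hLB.exists_equiv_prod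
      obtain ⟨Y', ⟨eY⟩⟩ := hLY.exists_equiv_prod
      refine hmin B' ⟨ModuleCat.of R (A × L), Y',
        ⟨(e.trans ((LinearEquiv.refl R A).prodCongr eB)).trans
          (LinearEquiv.prodAssoc R A L B').symm⟩,
        ⟨(e'.trans ((LinearEquiv.refl R A).prodCongr eY)).trans
          (LinearEquiv.prodAssoc R A L Y').symm⟩⟩ ?_
      have := ((isSummand_prod_right L B').trans
        (IsSummand.of_equiv (A := ModuleCat.of R (L × B')) eB.symm)).finite
      exact length_lt_prod.trans_eq eB.symm.length_eq

theorem IsBasic.nonempty_equiv {M N : ModuleCat.{0} R} [Module.Finite R M] [Module.Finite R N]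
    (hM : IsBasic M) (hN : IsBasic N) (h : MemAdd N M) (h' : MemAdd M N) :
    Nonempty (M ≃ₗ[R] N) := by
  obtain ⟨B, ⟨e⟩⟩ := (hM.isSummand h).exists_equiv_prod
  obtain ⟨C, ⟨e'⟩⟩ := (hN.isSummand h').exists_equiv_prod
  rcases subsingleton_or_nontrivial B with hB | hB
  · have : Unique B := uniqueOfSubsingleton 0
    exact ⟨(e.trans LinearEquiv.prodUnique).symm⟩
  · exfalso
    have h1 : Module.length R M < Module.length R N := by
      rw [e.length_eq, (LinearEquiv.prodComm R M B).length_eq]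
      exact length_lt_prod
    have h2 : Module.length R N ≤ Module.length R M := by
      rw [e'.length_eq, Module.length_prod]
      exact le_self_add
    exact absurd h1 h2.not_gt

/-- Every finitely generated module has a basic version. -/
theorem exists_isBasic (M : ModuleCat.{0} R) [Module.Finite R M] :
    ∃ N : ModuleCat.{0} R, IsBasic N ∧ MemAdd M N ∧ MemAdd N M := by
  obtain ⟨N, ⟨h, h'⟩, hmin⟩ :=
    (InvImage.wf (fun A : ModuleCat.{0} R => Module.length R A) wellFounded_lt).has_min
      {N | MemAdd M N ∧ MemAdd N M} ⟨M, MemAdd.refl M, MemAdd.refl M⟩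
  refine ⟨N, fun X hX => ?_, h, h'⟩
  by_contra hX0
  rw [not_subsingleton_iff_nontrivial] at hX0
  have := h.finite
  obtain ⟨Y, ⟨e⟩⟩ := hX.exists_equiv_prod
  let e' : N ≃ₗ[R] (X × (X × Y)) := e.trans (LinearEquiv.prodAssoc R X X Y)
  have hXY : IsSummand (ModuleCat.of R (X × Y)) N :=
    (isSummand_prod_right X (ModuleCat.of R (X × Y))).trans
      (IsSummand.of_equiv (A := ModuleCat.of R (X × (X × Y))) e'.symm)
  have := hXY.finite
  refine hmin (ModuleCat.of R (X × Y)) ⟨h.trans hXY.memAdd, MemAdd.trans ?_ h'⟩ ?_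
  · have h1 : MemAdd (ModuleCat.of R (X × Y)) (ModuleCat.of R (X × (X × Y))) :=
      MemAdd.prod (B := ModuleCat.of R (X × Y)) (isSummand_prod_left X Y).memAdd (MemAdd.refl _)
    exact h1.trans (IsSummand.of_equiv e').memAdd
  · exact (length_lt_prod (B := ModuleCat.of R (X × Y))).trans_eq e'.symm.length_eq

end FiniteLength

/-- A finitely generated module that is separated by maps to `X` embeds into a module in `add X`. -/
theorem exists_injective_memAdd {X M : ModuleCat.{0} R} [IsArtinian R M]
    (h : ∀ m : M, m ≠ 0 → ∃ f : M →ₗ[R] X, f m ≠ 0) :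
    ∃ (Y : ModuleCat.{0} R) (g : M →ₗ[R] Y), MemAdd X Y ∧ Function.Injective g := by
  obtain ⟨_, ⟨Y, g, hY, rfl⟩, hmin⟩ := IsArtinian.set_has_minimal
    {p : Submodule R M | ∃ (Y : ModuleCat.{0} R) (g : M →ₗ[R] Y), MemAdd X Y ∧
      LinearMap.ker g = p}
    ⟨_, ModuleCat.of R PUnit, 0, MemAdd.of_subsingleton _ _, rfl⟩
  refine ⟨Y, g, hY, LinearMap.ker_eq_bot.1 ((Submodule.eq_bot_iff _).2 fun m hm => ?_)⟩
  by_contra hm0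
  obtain ⟨f, hf⟩ := h m hm0
  refine hmin (LinearMap.ker (g.prod f))
    ⟨ModuleCat.of R (Y × X), g.prod f, hY.prod (MemAdd.refl X), rfl⟩ ?_
  rw [LinearMap.ker_prod]
  exact lt_of_le_of_ne inf_le_left fun he => hf (inf_eq_left.1 he hm)

theorem exists_surjective_memAdd {X M : ModuleCat.{0} R} [Module.Finite R M]
    (h : ∀ m : M, ∃ (f : X →ₗ[R] M) (x : X), f x = m) :
    ∃ (Y : ModuleCat.{0} R) (g : Y →ₗ[R] M), MemAdd X Y ∧ Function.Surjective g := by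
  obtain ⟨n, s, hs⟩ := Module.Finite.exists_fin (R := R) (M := M)
  choose f x hx using fun i => h (s i)
  refine ⟨ModuleCat.of R (Fin n → X), ∑ i, f i ∘ₗ LinearMap.proj i, memAdd_pi X n, ?_⟩
  rw [← LinearMap.range_eq_top, eq_top_iff, ← hs, Submodule.span_le]
  rintro _ ⟨i, rfl⟩
  refine ⟨Pi.single i (x i), ?_⟩
  rw [LinearMap.sum_apply, Finset.sum_eq_single i]
  · simp [hx]
  · intro j _ hj
    simp [hj]
  · simp

theorem memAdd_reg_of_projective (P : ModuleCat.{0} R) [Module.Finite R P]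
    [Module.Projective R P] : MemAdd (reg R) P := by
  obtain ⟨n, f, hf⟩ := Module.Finite.exists_fin' R P
  obtain ⟨g, hg⟩ := Module.projective_lifting_property f LinearMap.id hf
  exact ⟨n, g, f, hg⟩

section Artinian

variable [IsArtinianRing R]

/-- A finitely generated submodule of a projective-injective module is contained in a finitely
generated projective-injective module. -/
theorem exists_finite_projInj
    (hI : ∀ M : ModuleCat.{0} R, Module.Finite R M → ∃ (E : ModuleCat.{0} R) (u : M →ₗ[R] E),
      Module.Finite R E ∧ Module.Injective R E ∧ Function.Injective u)
    {N Y : ModuleCat.{0} R} [Module.Finite R N] (hY : ProjInj Y) (i : N →ₗ[R] Y)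
    (hi : Function.Injective i) :
    ∃ (E : ModuleCat.{0} R) (u : N →ₗ[R] E),
      Module.Finite R E ∧ ProjInj E ∧ Function.Injective u := by
  obtain ⟨E, ⟨u, hE, hE', hu⟩, hmin⟩ :=
    (InvImage.wf (fun A : ModuleCat.{0} R => Module.length R A) wellFounded_lt).has_min
      {E | ∃ u : N →ₗ[R] E, Module.Finite R E ∧ Module.Injective R E ∧ Function.Injective u}
      (hI N ‹_›)
  have hY1 := hY.1
  have hY2 := hY.2
  obtain ⟨p, hp⟩ := Module.Injective.out u hu i
  obtain ⟨q, hq⟩ := Module.Injective.out i hi u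
  let f : Module.End R E := q ∘ₗ p
  have hfu : ∀ x, f (u x) = u x := fun x => (congrArg q (hp x)).trans (hq x)
  have hfnu : ∀ n x, (f ^ n) (u x) = u x := by
    intro n x
    induction n with
    | zero => rfl
    | succ n ih => rw [pow_succ, Module.End.mul_apply, hfu, ih]
  obtain ⟨n, hn⟩ := Filter.eventually_atTop.1 (LinearMap.eventually_isCompl_ker_pow_range_pow f)
  have hc := hn (n + 1) (by omega)
  have hsum := isSummand_of_isCompl hc.symm
  have ht : LinearMap.range (f ^ (n + 1)) = ⊤ := by
    by_contra ht
    refine hmin (ModuleCat.of R (LinearMap.range (f ^ (n + 1))))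
      ⟨u.codRestrict _ fun x => ⟨u x, hfnu _ x⟩, hsum.finite, hsum.injective, ?_⟩
      (Submodule.length_lt ht)
    intro x y hxy
    exact hu (congrArg Subtype.val hxy)
  have hunit : IsUnit f := by
    rw [Module.End.isUnit_iff]
    have hs : Function.Surjective f := by
      have := LinearMap.range_eq_top.1 ht
      rw [pow_succ'] at this
      exact Function.Surjective.of_comp (g := (f ^ n : Module.End R E)) this
    exact IsNoetherian.bijective_of_surjective_endomorphism f hs
  have hEY : IsSummand E Y := isSummand_of_isUnit q p hunit
  exact ⟨E, u, hE, ⟨hEY.memAdd.projective, hE'⟩, hu⟩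

theorem memAdd_of_projInj {P : ModuleCat.{0} R} (hP : IsMaxProjInjSummand P)
    {Q : ModuleCat.{0} R} (hf : Module.Finite R Q) (hQ : ProjInj Q) : MemAdd P Q := by
  by_contra hn
  obtain ⟨Q, ⟨hf, hQ, hn⟩, hmin⟩ :=
    (InvImage.wf (fun A : ModuleCat.{0} R => Module.length R A) wellFounded_lt).has_min
      {Q | Module.Finite R Q ∧ ProjInj Q ∧ ¬ MemAdd P Q} ⟨Q, hf, hQ, hn⟩
  have hQ1 := hQ.1
  have hQ2 := hQ.2
  rcases subsingleton_or_nontrivial Q with h0 | h0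
  · exact hn (MemAdd.of_subsingleton P Q)
  obtain ⟨L, hLQ, hL⟩ := exists_isLocalRing_isSummand Q
  obtain ⟨B, ⟨e⟩⟩ := hLQ.exists_equiv_prod
  have hBQ : IsSummand B Q :=
    (isSummand_prod_right L B).trans (IsSummand.of_equiv (A := ModuleCat.of R (L × B)) e.symm)
  have := hLQ.finite
  have := hBQ.finite
  have := hLQ.memAdd.projective
  have hLn := nontrivial_of_isLocalRing_end L
  have hPL : MemAdd P L := hP.2.2 L (memAdd_reg_of_projective L).isSummand
    ⟨this, hLQ.injective⟩
  have hPB : MemAdd P B := by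
    by_contra hB
    exact hmin B ⟨hBQ.finite, ⟨hBQ.memAdd.projective, hBQ.injective⟩, hB⟩
      (length_lt_prod.trans_eq e.symm.length_eq)
  exact hn ((hPL.prod hPB).trans (IsSummand.of_equiv e).memAdd)

/-- The homological criterion for the existence of a copresentation by an injective module. -/
theorem exists_chain_of_extVan {P : ModuleCat.{0} R} [Module.Injective R P] (k : ℕ)
    (N : ModuleCat.{0} R) [Module.Finite R N]
    [Module.Finite R P]
    (h : ∀ S : ModuleCat.{0} R, Module.Finite R S → ExtVan S P 0 → ∀ j < k, ExtVan S N j) :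
    ∃ X, Chain (MemAdd P) k N X := by
  induction k generalizing N with
  | zero => exact ⟨N, Chain.nil (LinearEquiv.refl R N)⟩
  | succ k ih =>
    obtain ⟨Y, g, hY, hg⟩ := exists_injective_memAdd (X := P) (M := N) (by
      intro m hm
      by_contra! hf
      let S : Submodule R N := ⨅ f : N →ₗ[R] P, LinearMap.ker f
      have hS : ExtVan (ModuleCat.of R S) P 0 := by
        rw [extVan_zero_iff]
        intro u
        obtain ⟨v, hv⟩ := Module.Injective.out S.subtype S.injective_subtype u
        ext x
        rw [← hv x]
        exact (Submodule.mem_iInf _).1 x.2 v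
      have h0 := (extVan_zero_iff _ _).1
        (h (ModuleCat.of R S) (inferInstanceAs (Module.Finite R S)) hS 0 (by omega)) S.subtype
      have hmS : m ∈ S := (Submodule.mem_iInf _).2 hf
      exact hm (LinearMap.congr_fun h0 ⟨m, hmS⟩))
    have hs := isShortExact_range g hg
    have := hY.finite
    have := hY.injective
    obtain ⟨X, c⟩ := ih (ModuleCat.of R (Y ⧸ LinearMap.range g)) (fun S hS hSP j hj =>
      hs.extVan_right (h S hS hSP (j + 1) (by omega)) (by
        cases j with
        | zero => exact hY.extVan_right hSP
        | succ j => exact extVan_of_injective _ _ _))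
    exact ⟨X, Chain.cons hs hY c⟩

theorem exists_chain_of_domdim
    (hI : ∀ M : ModuleCat.{0} R, Module.Finite R M → ∃ (E : ModuleCat.{0} R) (u : M →ₗ[R] E),
      Module.Finite R E ∧ Module.Injective R E ∧ Function.Injective u)
    {P : ModuleCat.{0} R} (hP : IsMaxProjInjSummand P) {k : ℕ} (hk : DomdimGE R k) :
    ∃ X, Chain (MemAdd P) k (reg R) X := by
  obtain ⟨Y, g, f, hg, hgf, hff, hYi, hYp⟩ := hk
  obtain ⟨N, c⟩ := Chain.of_coresolution (P := ProjInj) k (reg R) Y g f hg hgf hff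
    (fun i hi => ⟨hYp i hi, hYi i⟩)
  have hR : Module.Finite R (reg R) := inferInstanceAs (Module.Finite R R)
  have := hP.2.1.2
  have := hP.1.finite
  refine exists_chain_of_extVan k (reg R) fun S hS hSP j hj =>
    c.extVan_of_hom_eq_zero (fun Y hY j => ?_) j hj
  have hY2 := hY.2
  cases j with
  | succ j => exact extVan_of_injective _ _ _
  | zero =>
    rw [extVan_zero_iff]
    intro f
    have : Module.Finite R (ModuleCat.of R (LinearMap.range f)) :=
      inferInstanceAs (Module.Finite R (LinearMap.range f))
    obtain ⟨E, u, hE, hE', hu⟩ := exists_finite_projInj hI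
      (N := ModuleCat.of R (LinearMap.range f)) hY (LinearMap.range f).subtype
      (Submodule.injective_subtype _)
    have h0 := (extVan_zero_iff S E).1 ((memAdd_of_projInj hP hE hE').extVan_right hSP)
      (u ∘ₗ f.rangeRestrict)
    ext x
    have : f.rangeRestrict x = 0 := hu (by simpa using LinearMap.congr_fun h0 x)
    exact congrArg Subtype.val this

end Artinian

/-- Dualising a copresentation of the regular module: modules without higher extensions from
its cokernel are presented by the same projective-injective module. -/
theorem Chain.exists_chain_end [IsNoetherianRing R] {P X : ModuleCat.{0} R} {k : ℕ} (hP : ProjInj P)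
    [Module.Finite R P] (c : Chain (MemAdd P) k (reg R) X) (i : ℕ) (hi : i ≤ k)
    (M : ModuleCat.{0} R) [Module.Finite R M]
    (h : ∀ j, k ≤ j + i → ExtVan X M (j + 1)) :
    ∃ Z : ModuleCat.{0} R, Module.Finite R Z ∧ Chain (MemAdd P) i Z M := by
  induction i generalizing M with
  | zero => exact ⟨M, ‹_›, Chain.nil (LinearEquiv.refl R M)⟩
  | succ i ih =>
    have hP1 := hP.1
    have hP2 := hP.2
    have hsurj : ∃ (Y : ModuleCat.{0} R) (g : Y →ₗ[R] M), MemAdd P Y ∧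
        Function.Surjective g := by
      cases c with
      | nil e => omega
      | @cons k _ t L _ f g hs ht c =>
        have hL : ExtVan L M 1 := c.extVan_start' (j := 0)
          (fun Y hY j => by
            have := hY.projective
            exact extVan_of_projective _ _ _)
          (by
            have := h k (by omega)
            rwa [zero_add, add_comm])
        obtain ⟨Y, v, hY, hv⟩ := exists_surjective_memAdd (X := t) (M := M) fun m => by
          obtain ⟨v, hv⟩ := hs.exists_extension hL (LinearMap.toSpanSingleton R M m)
          exact ⟨v, f (1 : R), (LinearMap.congr_fun hv (1 : R)).trans (one_smul R m)⟩
        exact ⟨Y, v, ht.trans hY, hv⟩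
    obtain ⟨Y, g, hY, hg⟩ := hsurj
    have := hY.finite
    have := hY.injective
    have hs := isShortExact_ker g hg
    have hK : Module.Finite R (ModuleCat.of R (LinearMap.ker g)) :=
      inferInstanceAs (Module.Finite R (LinearMap.ker g))
    obtain ⟨Z, hZ, c'⟩ := ih (by omega) (ModuleCat.of R (LinearMap.ker g)) (fun j hj => by
      obtain ⟨j, rfl⟩ : ∃ j', j = j' + 1 := ⟨j - 1, by omega⟩
      exact hs.extVan_left (h j (by omega)) (extVan_of_injective _ _ _))
    exact ⟨Z, hZ, c'.snoc hs hY⟩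

section Dual

variable (K : Type) [Field K] {R : Type} [Ring R] [Algebra K R]

theorem Dreg_smul_apply (s : R) (φ : Dreg K R) (x : R) :
    (show R →ₗ[K] K from s • φ) x = (show R →ₗ[K] K from φ) (x * s) := rfl

/-- The module map to `D R` corresponding to a `K`-linear functional. -/
def toDreg (M : ModuleCat.{0} R) (φ : letI := kMod K M; M →ₗ[K] K) : M →ₗ[R] Dreg K R :=
  letI := kMod K M
  { toFun := fun m => show R →ₗ[K] K from
      { toFun := fun r => φ (r • m)
        map_add' := fun r s => by rw [add_smul, map_add]
        map_smul' := fun c r => by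
          rw [Algebra.smul_def, mul_smul]
          exact map_smul φ c (r • m) }
    map_add' := fun m m' => by
      refine LinearMap.ext fun r => ?_
      exact (congrArg φ (smul_add r m m')).trans (map_add φ _ _)
    map_smul' := fun s m => by
      refine LinearMap.ext fun r => ?_
      exact congrArg φ (smul_smul r s m) }

theorem toDreg_apply (M : ModuleCat.{0} R) (φ : letI := kMod K M; M →ₗ[K] K) (m : M) (r : R) :
    (show R →ₗ[K] K from toDreg K M φ m) r = φ (r • m) := rfl

theorem exists_Dreg_apply_ne_zero (M : ModuleCat.{0} R) (m : M) (hm : m ≠ 0) :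
    ∃ f : M →ₗ[R] Dreg K R, f m ≠ 0 := by
  let := kMod K M
  obtain ⟨φ, hφ⟩ := Module.Projective.exists_dual_ne_zero K hm
  refine ⟨toDreg K M φ, fun h0 => hφ ?_⟩
  have h1 := toDreg_apply K M φ m 1
  rw [one_smul] at h1
  exact h1.symm.trans (congrArg (fun d : Dreg K R => (show R →ₗ[K] K from d) 1) h0)

theorem Dreg_injective : Module.Injective R (Dreg K R) := by
  refine ⟨fun U V _ _ _ _ f hf g => ?_⟩
  let : Module K U := kMod K (ModuleCat.of R U)
  let : Module K V := kMod K (ModuleCat.of R V)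
  let fK : U →ₗ[K] V := { f with map_smul' := fun c x => f.map_smul (algebraMap K R c) x }
  let ev : U →ₗ[K] K :=
    { toFun := fun u => (show R →ₗ[K] K from g u) 1
      map_add' := fun u u' => by
        rw [map_add]
        rfl
      map_smul' := fun c u => by
        have h1 : g (c • u) = algebraMap K R c • g u := g.map_smul (algebraMap K R c) u
        rw [h1]
        refine (Dreg_smul_apply K _ _ _).trans ?_
        rw [one_mul, Algebra.algebraMap_eq_smul_one]
        exact map_smul (show R →ₗ[K] K from g u) c 1 }
  obtain ⟨l, hl⟩ := fK.exists_leftInverse_of_injective (LinearMap.ker_eq_bot.2 hf)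
  refine ⟨toDreg K (ModuleCat.of R V) (ev ∘ₗ l), fun u => LinearMap.ext fun r => ?_⟩
  refine (toDreg_apply K (ModuleCat.of R V) (ev ∘ₗ l) (f u) r).trans ?_
  have h1 : r • f u = fK (r • u) := (f.map_smul r u).symm
  have h2 : l (fK (r • u)) = r • u := LinearMap.congr_fun hl (r • u)
  refine (congrArg (ev ∘ₗ l) h1).trans ((congrArg ev h2).trans ?_)
  have h3 : g (r • u) = r • g u := g.map_smul r u
  refine (congrArg (fun d : Dreg K R => (show R →ₗ[K] K from d) 1) h3).trans ?_
  refine (Dreg_smul_apply K _ _ _).trans ?_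
  rw [one_mul]

theorem Dreg_finite [FiniteDimensional K R] : Module.Finite R (Dreg K R) := by
  let : Module K (Dreg K R) := inferInstanceAs (Module K (R →ₗ[K] K))
  have : Module.Finite K (Dreg K R) := inferInstanceAs (Module.Finite K (R →ₗ[K] K))
  have : IsScalarTower K R (Dreg K R) := ⟨fun c r φ => LinearMap.ext fun x => by
    refine (Dreg_smul_apply K _ _ _).trans ?_
    rw [mul_smul_comm]
    exact map_smul (show R →ₗ[K] K from φ) c (x * r)⟩
  exact Module.Finite.of_restrictScalars_finite K R _

theorem exists_finite_injective [FiniteDimensional K R] (M : ModuleCat.{0} R)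
    (hM : Module.Finite R M) : ∃ (E : ModuleCat.{0} R) (u : M →ₗ[R] E),
      Module.Finite R E ∧ Module.Injective R E ∧ Function.Injective u := by
  have := IsArtinianRing.of_finite K R
  have := Dreg_finite K (R := R)
  have := Dreg_injective K (R := R)
  obtain ⟨E, u, hE, hu⟩ := exists_injective_memAdd (exists_Dreg_apply_ne_zero K M)
  exact ⟨E, u, hE.finite, hE.injective, hu⟩

theorem finite_kMod [FiniteDimensional K R] (M : ModuleCat.{0} R) [Module.Finite R M] :
    letI := kMod K M; Module.Finite K M := by
  let := kMod K M
  have : IsScalarTower K R M := ⟨fun c r m => by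
    rw [Algebra.smul_def, mul_smul]
    rfl⟩
  exact Module.Finite.trans R M

theorem exists_fin_span_hom [FiniteDimensional K R] (M N : ModuleCat.{0} R) [Module.Finite R M]
    [Module.Finite R N] : ∃ (n : ℕ) (s : Fin n → (M →ₗ[R] N)), ∀ u : M →ₗ[R] N,
      ∃ c : Fin n → R, (∀ i r, c i * r = r * c i) ∧ ∀ m, u m = ∑ i, c i • s i m := by
  let := kMod K M
  let := kMod K N
  have := finite_kMod K M
  have := finite_kMod K N
  have := kMod_smulCommClass K N
  let F : (M →ₗ[R] N) →ₗ[K] (M →ₗ[K] N) :=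
    { toFun := fun u => { u with map_smul' := fun c x => u.map_smul (algebraMap K R c) x }
      map_add' := fun _ _ => rfl
      map_smul' := fun _ _ => rfl }
  have hF : Function.Injective F := fun u v h => LinearMap.ext fun x => LinearMap.congr_fun h x
  have : Module.Finite K (M →ₗ[R] N) := Module.Finite.of_injective F hF
  obtain ⟨n, s, hs⟩ := Module.Finite.exists_fin (R := K) (M := M →ₗ[R] N)
  refine ⟨n, s, fun u => ?_⟩
  obtain ⟨c, hc⟩ := (Submodule.mem_span_range_iff_exists_fun K).1
    (hs ▸ Submodule.mem_top : u ∈ Submodule.span K (Set.range s))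
  refine ⟨fun i => algebraMap K R (c i), fun i r => Algebra.commutes _ _, fun m => ?_⟩
  rw [← hc, LinearMap.sum_apply]
  rfl

end Dual

theorem exists_right_approximation (K : Type) [Field K] [Algebra K R] [FiniteDimensional K R]
    (T M : ModuleCat.{0} R) [Module.Finite R T]
    [Module.Finite R M] : ∃ (Y : ModuleCat.{0} R) (g : Y →ₗ[R] M), MemAdd T Y ∧
      ∀ Z, MemAdd T Z → ∀ u : Z →ₗ[R] M, ∃ v : Z →ₗ[R] Y, g ∘ₗ v = u := by
  obtain ⟨n, s, hs⟩ := exists_fin_span_hom K T M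
  have key : ∀ u : T →ₗ[R] M, ∃ v : T →ₗ[R] (Fin n → T),
      (∑ i, s i ∘ₗ LinearMap.proj i) ∘ₗ v = u := fun u => by
    obtain ⟨c, hc, hu⟩ := hs u
    refine ⟨LinearMap.pi fun i =>
      { toFun := fun t => c i • t
        map_add' := smul_add _
        map_smul' := fun r t => by
          simp only [RingHom.id_apply, smul_smul, hc] }, LinearMap.ext fun t => ?_⟩
    rw [hu]
    simp
  refine ⟨ModuleCat.of R (Fin n → T), ∑ i, s i ∘ₗ LinearMap.proj i, memAdd_pi T n,
    fun Z hZ u => ?_⟩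
  obtain ⟨m, a, b, hab⟩ := memAdd_iff.1 hZ
  choose v hv using fun i => key (u ∘ₗ a i)
  refine ⟨∑ i, v i ∘ₗ b i, LinearMap.ext fun z => ?_⟩
  have h1 : ∀ i t, (∑ i, s i ∘ₗ LinearMap.proj i : (Fin n → T) →ₗ[R] M) (v i t) = u (a i t) :=
    fun i t => LinearMap.congr_fun (hv i) t
  rw [LinearMap.comp_apply, LinearMap.sum_apply (f := fun i => v i ∘ₗ b i)]
  refine ((map_sum _ _ _).trans (Finset.sum_congr rfl fun i _ => h1 i (b i z))).trans ?_
  rw [← map_sum, hab]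

theorem exists_left_approximation (K : Type) [Field K] [Algebra K R] [FiniteDimensional K R]
    (T M : ModuleCat.{0} R) [Module.Finite R T]
    [Module.Finite R M] : ∃ (Y : ModuleCat.{0} R) (g : M →ₗ[R] Y), MemAdd T Y ∧
      ∀ Z, MemAdd T Z → ∀ u : M →ₗ[R] Z, ∃ v : Y →ₗ[R] Z, v ∘ₗ g = u := by
  obtain ⟨n, s, hs⟩ := exists_fin_span_hom K M T
  have key : ∀ u : M →ₗ[R] T, ∃ v : (Fin n → T) →ₗ[R] T,
      v ∘ₗ LinearMap.pi s = u := fun u => by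
    obtain ⟨c, hc, hu⟩ := hs u
    refine ⟨∑ i, LinearMap.comp
      { toFun := fun t => c i • t
        map_add' := smul_add _
        map_smul' := fun r t => by
          simp only [RingHom.id_apply, smul_smul, hc] } (LinearMap.proj i),
      LinearMap.ext fun t => ?_⟩
    rw [hu]
    simp
  refine ⟨ModuleCat.of R (Fin n → T), LinearMap.pi s, memAdd_pi T n, fun Z hZ u => ?_⟩
  obtain ⟨m, a, b, hab⟩ := memAdd_iff.1 hZ
  choose v hv using fun i => key (b i ∘ₗ u)
  refine ⟨∑ i, a i ∘ₗ v i, LinearMap.ext fun z => ?_⟩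
  have h1 : ∀ i, v i (LinearMap.pi s z) = b i (u z) := fun i => LinearMap.congr_fun (hv i) z
  rw [LinearMap.comp_apply, LinearMap.sum_apply]
  refine (Finset.sum_congr rfl fun i _ => congrArg (a i) (h1 i)).trans ?_
  exact hab (u z)

theorem Chain.exists_snoc {P : ModuleCat.{0} R → Prop} {k : ℕ} {M N : ModuleCat.{0} R}
    (c : Chain P (k + 1) M N) : ∃ (L Z : ModuleCat.{0} R) (f : L →ₗ[R] Z) (g : Z →ₗ[R] N),
      IsShortExact f g ∧ P Z ∧ Chain P k M L := by
  induction k generalizing M with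
  | zero =>
    cases c with
    | @cons _ _ Y M' _ f g hs hY c =>
      cases c with
      | nil e =>
        refine ⟨M, Y, f, e.toLinearMap ∘ₗ g, ⟨hs.inj, ?_, e.surjective.comp hs.surj⟩, hY,
          Chain.nil (LinearEquiv.refl R M)⟩
        exact hs.exact.comp_injective e e.injective (map_zero e)
  | succ k ih =>
    cases c with
    | cons hs hY c =>
      obtain ⟨L, Z, f, g, hs', hZ, c'⟩ := ih c
      exact ⟨L, Z, f, g, hs', hZ, Chain.cons hs hY c'⟩

section Tilting

variable {T t : ModuleCat.{0} R} [Module.Finite R T] {k : ℕ}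

theorem exists_tilting_presentation (K : Type) [Field K] [Algebra K R] [FiniteDimensional K R]
    (c : Chain (MemAdd T) k (reg R) t) (ht : MemAdd T t)
    (hT : ∀ j, ExtVan T T (j + 1)) (M : ModuleCat.{0} R) [Module.Finite R M]
    (hM : ∀ j, ExtVan T M (j + 1)) :
    ∃ (L Y : ModuleCat.{0} R) (f : L →ₗ[R] Y) (g : Y →ₗ[R] M), IsShortExact f g ∧
      MemAdd T Y ∧ Module.Finite R L ∧ ∀ j, ExtVan T L (j + 1) := by
  have := IsArtinianRing.of_finite K R
  obtain ⟨Y, g, hY, hg⟩ := exists_right_approximation K T M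
  have hfac : ∀ m : M, ∃ (Z : ModuleCat.{0} R) (f : reg R →ₗ[R] Z) (v : Z →ₗ[R] M),
      MemAdd T Z ∧ v ∘ₗ f = LinearMap.toSpanSingleton R M m := fun m => by
    cases c with
    | nil e =>
      refine ⟨t, e.toLinearMap, LinearMap.toSpanSingleton R M m ∘ₗ e.symm.toLinearMap, ht,
        LinearMap.ext fun x => ?_⟩
      exact congrArg (LinearMap.toSpanSingleton R M m) (e.symm_apply_apply x)
    | @cons k _ Z L _ f g hs hZ c =>
      have hL : ExtVan L M 1 := c.extVan_start' (j := 0)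
        (fun Y hY j => hY.extVan_left (hM j)) (by
          rw [zero_add, add_comm]
          exact ht.extVan_left (hM k))
      obtain ⟨v, hv⟩ := hs.exists_extension hL (LinearMap.toSpanSingleton R M m)
      exact ⟨Z, f, v, hZ, hv⟩
  have hsurj : Function.Surjective g := fun m => by
    obtain ⟨Z, f, v, hZ, hv⟩ := hfac m
    obtain ⟨w, hw⟩ := hg Z hZ v
    refine ⟨w (f (1 : R)), ?_⟩
    refine (LinearMap.congr_fun hw (f (1 : R))).trans ?_
    exact (LinearMap.congr_fun hv (1 : R)).trans (one_smul R m)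
  have hs := isShortExact_ker g hsurj
  have := hY.finite
  refine ⟨_, Y, _, g, hs, hY, inferInstanceAs (Module.Finite R (LinearMap.ker g)), fun j => ?_⟩
  cases j with
  | zero => exact hs.extVan_one_of_lift (hY.extVan_right (hT 0)) (hg T (MemAdd.refl T))
  | succ j => exact hs.extVan_left (hM j) (hY.extVan_right (hT _))

theorem memAdd_of_tilting_chain (K : Type) [Field K] [Algebra K R] [FiniteDimensional K R]
    (c : Chain (MemAdd T) k (reg R) t) (ht : MemAdd T t)
    (hT : ∀ j, ExtVan T T (j + 1)) {T' : ModuleCat.{0} R} [Module.Finite R T']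
    (h : ∀ j, ExtVan T T' (j + 1)) (h' : ∀ j, ExtVan T' T (j + 1)) (d : ℕ)
    (hd : ∀ S j, ExtVan T' S (j + 1 + d)) : MemAdd T T' := by
  have key : ∀ n, ∀ M : ModuleCat.{0} R, Module.Finite R M → (∀ j, ExtVan T M (j + 1)) →
      ∀ j, d ≤ j + n → ExtVan T' M (j + 1) := by
    intro n
    induction n with
    | zero =>
      intro M _ _ j hj
      have := hd M (j - d)
      rwa [show j - d + 1 + d = j + 1 by omega] at this
    | succ n ih =>
      intro M hMf hM j hj
      obtain ⟨L, Y, f, g, hs, hY, hL, hTL⟩ := exists_tilting_presentation K c ht hT M hM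
      exact hs.extVan_right (ih L hL hTL (j + 1) (by omega)) (hY.extVan_right (h' j))
  obtain ⟨L, Y, f, g, hs, hY, hL, hTL⟩ := exists_tilting_presentation K c ht hT T' h
  obtain ⟨v, hv⟩ := hs.exists_lift (key d L hL hTL 0 (by omega)) LinearMap.id
  exact hY.trans (IsSummand.memAdd ⟨v, g, hv⟩)

end Tilting

section Cotilting

variable {C c₀ : ModuleCat.{0} R} [Module.Finite R C] {k : ℕ}

theorem exists_cotilting_copresentation (K : Type) [Field K] [Algebra K R] [FiniteDimensional K R]
    (c : Chain (MemAdd C) k c₀ (Dreg K R))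
    (hc : MemAdd C c₀) (hC : ∀ j, ExtVan C C (j + 1)) (M : ModuleCat.{0} R) [Module.Finite R M]
    (hM : ∀ j, ExtVan M C (j + 1)) :
    ∃ (Y Q : ModuleCat.{0} R) (f : M →ₗ[R] Y) (g : Y →ₗ[R] Q), IsShortExact f g ∧
      MemAdd C Y ∧ Module.Finite R Q ∧ ∀ j, ExtVan Q C (j + 1) := by
  obtain ⟨Y, g, hY, hg⟩ := exists_left_approximation K C M
  have hfac : ∀ u : M →ₗ[R] Dreg K R, ∃ (Z : ModuleCat.{0} R) (f : Z →ₗ[R] Dreg K R)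
      (v : M →ₗ[R] Z), MemAdd C Z ∧ f ∘ₗ v = u := fun u => by
    cases k with
    | zero =>
      cases c with
      | nil e =>
        refine ⟨c₀, e.toLinearMap, e.symm.toLinearMap ∘ₗ u, hc, LinearMap.ext fun x => ?_⟩
        exact e.apply_symm_apply (u x)
    | succ k =>
      obtain ⟨L, Z, f, g, hs, hZ, c⟩ := c.exists_snoc
      have hL : ExtVan M L 1 := c.extVan_end (j := 0)
        (fun Y hY j => hY.extVan_right (hM j)) (by
          rw [zero_add, add_comm]
          exact hc.extVan_right (hM k))
      obtain ⟨v, hv⟩ := hs.exists_lift hL u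
      exact ⟨Z, g, v, hZ, hv⟩
  have hinj : Function.Injective g := by
    rw [injective_iff_map_eq_zero]
    intro m hm
    by_contra hm0
    obtain ⟨u, hu⟩ := exists_Dreg_apply_ne_zero K M m hm0
    obtain ⟨Z, f, v, hZ, hv⟩ := hfac u
    obtain ⟨w, hw⟩ := hg Z hZ v
    apply hu
    rw [← hv, ← hw]
    simp [hm]
  have hs := isShortExact_range g hinj
  have := hY.finite
  refine ⟨Y, _, g, _, hs, hY, inferInstanceAs (Module.Finite R (Y ⧸ LinearMap.range g)),
    fun j => ?_⟩
  cases j with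
  | zero => exact hs.extVan_one_of_extension (hY.extVan_left (hC 0)) (hg C (MemAdd.refl C))
  | succ j => exact hs.extVan_right' (hM j) (hY.extVan_left (hC _))

theorem memAdd_of_cotilting_chain (K : Type) [Field K] [Algebra K R] [FiniteDimensional K R]
    (c : Chain (MemAdd C) k c₀ (Dreg K R)) (hc : MemAdd C c₀)
    (hC : ∀ j, ExtVan C C (j + 1)) {C' : ModuleCat.{0} R} [Module.Finite R C']
    (h : ∀ j, ExtVan C' C (j + 1)) (h' : ∀ j, ExtVan C C' (j + 1)) (d : ℕ)
    (hd : ∀ S j, ExtVan S C' (j + 1 + d)) : MemAdd C C' := by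
  have key : ∀ n, ∀ M : ModuleCat.{0} R, Module.Finite R M → (∀ j, ExtVan M C (j + 1)) →
      ∀ j, d ≤ j + n → ExtVan M C' (j + 1) := by
    intro n
    induction n with
    | zero =>
      intro M _ _ j hj
      have := hd M (j - d)
      rwa [show j - d + 1 + d = j + 1 by omega] at this
    | succ n ih =>
      intro M hMf hM j hj
      obtain ⟨Y, Q, f, g, hs, hY, hQ, hCQ⟩ := exists_cotilting_copresentation K c hc hC M hM
      exact hs.extVan_left' (ih Q hQ hCQ (j + 1) (by omega)) (hY.extVan_left (h' j))
  obtain ⟨Y, Q, f, g, hs, hY, hQ, hCQ⟩ := exists_cotilting_copresentation K c hc hC C' h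
  obtain ⟨v, hv⟩ := hs.exists_extension (key d Q hQ hCQ 0 (by omega)) LinearMap.id
  exact hY.trans (IsSummand.memAdd ⟨f, v, hv⟩)

end Cotilting

theorem extVan_prod_left {A B S : ModuleCat.{0} R} {j : ℕ} (hA : ExtVan A S j)
    (hB : ExtVan B S j) : ExtVan (ModuleCat.of R (A × B)) S j := by
  refine subsingleton_of_forall_eq 0 fun x => ?_
  have hid : 𝟙 (ModuleCat.of R (A × B)) =
      ModuleCat.ofHom (LinearMap.fst R A B) ≫ ModuleCat.ofHom (LinearMap.inl R A B) +
        ModuleCat.ofHom (LinearMap.snd R A B) ≫ ModuleCat.ofHom (LinearMap.inr R A B) := by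
    refine ModuleCat.hom_ext (LinearMap.ext fun m => ?_)
    exact Prod.ext (add_zero _).symm (zero_add _).symm
  rw [← Abelian.Ext.mk₀_id_comp x, hid, Abelian.Ext.mk₀_add, Abelian.Ext.add_comp,
    ← Abelian.Ext.mk₀_comp_mk₀_assoc, ← Abelian.Ext.mk₀_comp_mk₀_assoc,
    Subsingleton.elim (h := hA) (Abelian.Ext.comp _ x _) 0,
    Subsingleton.elim (h := hB) (Abelian.Ext.comp _ x _) 0, Abelian.Ext.comp_zero,
    Abelian.Ext.comp_zero, add_zero]

theorem extVan_prod_right {A B S : ModuleCat.{0} R} {j : ℕ} (hA : ExtVan S A j)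
    (hB : ExtVan S B j) : ExtVan S (ModuleCat.of R (A × B)) j := by
  refine subsingleton_of_forall_eq 0 fun x => ?_
  have hid : 𝟙 (ModuleCat.of R (A × B)) =
      ModuleCat.ofHom (LinearMap.fst R A B) ≫ ModuleCat.ofHom (LinearMap.inl R A B) +
        ModuleCat.ofHom (LinearMap.snd R A B) ≫ ModuleCat.ofHom (LinearMap.inr R A B) := by
    refine ModuleCat.hom_ext (LinearMap.ext fun m => ?_)
    exact Prod.ext (add_zero _).symm (zero_add _).symm
  rw [← Abelian.Ext.comp_mk₀_id x, hid, Abelian.Ext.mk₀_add, Abelian.Ext.comp_add,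
    ← Abelian.Ext.mk₀_comp_mk₀, ← Abelian.Ext.mk₀_comp_mk₀,
    ← Abelian.Ext.comp_assoc_of_third_deg_zero, ← Abelian.Ext.comp_assoc_of_third_deg_zero,
    Subsingleton.elim (h := hA) (Abelian.Ext.comp x _ _) 0,
    Subsingleton.elim (h := hB) (Abelian.Ext.comp x _ _) 0, Abelian.Ext.zero_comp,
    Abelian.Ext.zero_comp, add_zero]

/-- Adding a projective-injective summand does not affect higher extensions. -/
theorem ProjInj.extVan_prod {P A B : ModuleCat.{0} R} (hP : ProjInj P) {j : ℕ}
    (h : ExtVan A B (j + 1)) :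
    ExtVan (ModuleCat.of R (P × A)) (ModuleCat.of R (P × B)) (j + 1) := by
  have hP1 := hP.1
  have hP2 := hP.2
  exact extVan_prod_right (extVan_of_injective _ _ _)
    (extVan_prod_left (extVan_of_projective _ _ _) h)

section Tilting

variable {P T : ModuleCat.{0} R} {k : ℕ}

theorem exists_isSpecialTilting [IsArtinianRing R] {X : ModuleCat.{0} R} [Module.Finite R P]
    (hP : ProjInj P) (c : Chain (MemAdd P) k (reg R) X) :
    ∃ T : ModuleCat.{0} R, IsBasic T ∧ IsSpecialTilting P k T := by
  have hP1 := hP.1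
  have hP2 := hP.2
  have hR : Module.Projective R (reg R) := inferInstanceAs (Module.Projective R R)
  have hX : Module.Finite R X :=
    c.finite (fun Y hY => hY.finite) (inferInstanceAs (Module.Finite R R))
  have hd : ∀ S j, ExtVan X S (j + 1 + k) := fun S j => c.extVan_end'
    (fun Y hY j => hY.extVan_left (extVan_of_projective _ _ _)) j (extVan_of_projective _ _ _)
  have hXX : ∀ j, ExtVan X X (j + 1) := fun j => c.extVan_end
    (fun Y hY j => hY.extVan_right (extVan_of_injective _ _ _)) j (hd _ j)
  obtain ⟨T, hT, hUT, hTU⟩ := exists_isBasic (ModuleCat.of R (P × X))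
  have hTP : MemAdd T P := hTU.trans (isSummand_prod_left P X).memAdd
  have hTX : MemAdd T X := hTU.trans (isSummand_prod_right P X).memAdd
  obtain ⟨Y, f, hf, hY0, rfl, hY⟩ := c.exists_seq
  have hYT : ∀ i, 1 ≤ i → i ≤ k + 1 → MemAdd T (Y i) := fun i h1 h2 => by
    rcases Nat.lt_or_ge k i with h | h
    · obtain rfl : i = k + 1 := by omega
      exact hTX
    · exact hTP.trans (hY i h1 h)
  refine ⟨T, hT, ⟨hUT.finite, pdimLE_of_extVan fun S => ?_, (extVanishing_iff _ _).2 fun j => ?_,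
    Y, f, hf, hY0, hYT⟩, Y, f, hf, hY0, hYT, hY⟩
  · refine hUT.extVan_left (extVan_prod_left (extVan_of_projective _ _ _) ?_)
    have := hd S 0
    rwa [show 0 + 1 + k = k + 1 by omega] at this
  · exact hUT.extVan_left (hUT.extVan_right (hP.extVan_prod (hXX j)))

theorem IsSpecialTilting.exists_chain (K : Type) [Field K] [Algebra K R] [FiniteDimensional K R]
    (hT : IsSpecialTilting P k T) (hP : ProjInj P) (hPR : IsSummand P (reg R)) :
    ∃ t : ModuleCat.{0} R, Chain (MemAdd P) k (reg R) t ∧ MemAdd T t ∧ MemAdd T P ∧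
      MemAdd (ModuleCat.of R (P × t)) T := by
  obtain ⟨⟨hTf, hpd, hext, -⟩, Y, f, hf, hY0, hYT, hYP⟩ := hT
  have hP1 := hP.1
  have hP2 := hP.2
  have hext := (extVanishing_iff _ _).1 hext
  have ht : MemAdd T (Y (k + 1)) := hYT (k + 1) (by omega) le_rfl
  have c : Chain (fun Z => MemAdd T Z ∧ MemAdd P Z) k (Y 0) (Y (k + 1)) :=
    Chain.of_isExactSeq hf fun i h1 h2 => ⟨hYT i h1 (by omega), hYP i h1 h2⟩
  rw [hY0] at c
  generalize Y (k + 1) = t at c ht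
  have cP : Chain (MemAdd P) k (reg R) t := c.mono fun _ h => h.2
  have hTP : MemAdd T P := by
    cases c with
    | nil e => exact ht.trans (hPR.trans (IsSummand.of_equiv e)).memAdd
    | @cons _ _ _ _ _ g _ hs hZ _ =>
      obtain ⟨i, p, hip⟩ := hPR
      obtain ⟨v, hv⟩ := hs.exists_extension (extVan_of_injective _ P 0) p
      refine hZ.1.trans (IsSummand.memAdd ⟨g ∘ₗ i, v, ?_⟩)
      rw [← LinearMap.comp_assoc, hv, hip]
  have hTU : MemAdd T (ModuleCat.of R (P × t)) := hTP.prod ht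
  have := hTU.finite
  have hPU := (isSummand_prod_left P t).memAdd
  have hE := fun j => hTU.extVan_left (hTU.extVan_right (hext j))
  exact ⟨t, cP, ht, hTP, memAdd_of_tilting_chain K (cP.mono fun _ h => hPU.trans h)
    (isSummand_prod_right P t).memAdd hE (fun j => hTU.extVan_left (hext j))
    (fun j => hTU.extVan_right (hext j)) k hpd.extVan⟩

theorem IsSpecialTilting.memAdd (K : Type) [Field K] [Algebra K R] [FiniteDimensional K R]
    {T' : ModuleCat.{0} R} (hT : IsSpecialTilting P k T) (hT' : IsSpecialTilting P k T')
    (hP : ProjInj P) (hPR : IsSummand P (reg R)) : MemAdd T T' := by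
  obtain ⟨t, c, ht, hTP, hU⟩ := hT.exists_chain K hP hPR
  obtain ⟨t', c', ht', hTP', hU'⟩ := hT'.exists_chain K hP hPR
  have hP2 := hP.2
  have := hT.1.1
  have := hT'.1.1
  have cross : ∀ {t t' T : ModuleCat.{0} R}, MemAdd T t → PdimLE k T →
      Chain (MemAdd P) k (reg R) t' → ∀ j, ExtVan t t' (j + 1) := fun ht hpd c j =>
    c.extVan_end (fun Y hY j => hY.extVan_right (extVan_of_injective _ _ _)) j
      (ht.extVan_left (hpd.extVan _ j))
  refine memAdd_of_tilting_chain K (c.mono fun _ h => hTP.trans h) ht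
    ((extVanishing_iff _ _).1 hT.1.2.2.1) (fun j => ?_) (fun j => ?_) k hT'.1.2.1.extVan
  · exact hU.extVan_left (hU'.extVan_right (hP.extVan_prod (cross ht hT.1.2.1 c' j)))
  · exact hU'.extVan_left (hU.extVan_right (hP.extVan_prod (cross ht' hT'.1.2.1 c j)))

end Tilting

section Cotilting

variable (K : Type) [Field K] [Algebra K R] {P C : ModuleCat.{0} R} {k : ℕ}

theorem exists_isSpecialCotilting [IsArtinianRing R] {Z : ModuleCat.{0} R}
    [Module.Finite R P] [Module.Finite R Z]
    (hP : ProjInj P) (c : Chain (MemAdd P) k Z (Dreg K R)) :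
    ∃ C : ModuleCat.{0} R, IsBasic C ∧ IsSpecialCotilting K P k C := by
  have hP1 := hP.1
  have hP2 := hP.2
  have hD := Dreg_injective K (R := R)
  have hd : ∀ S j, ExtVan S Z (j + 1 + k) := fun S j => c.extVan_start
    (fun Y hY j => hY.extVan_right (extVan_of_injective _ _ _)) j (extVan_of_injective _ _ _)
  have hZZ : ∀ j, ExtVan Z Z (j + 1) := fun j => c.extVan_start'
    (fun Y hY j => hY.extVan_left (extVan_of_projective _ _ _)) j (hd _ j)
  obtain ⟨C, hC, hUC, hCU⟩ := exists_isBasic (ModuleCat.of R (P × Z))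
  have hCP : MemAdd C P := hCU.trans (isSummand_prod_left P Z).memAdd
  have hCZ : MemAdd C Z := hCU.trans (isSummand_prod_right P Z).memAdd
  obtain ⟨Y, f, hf, rfl, hYD, hY⟩ := c.exists_seq
  have hYC : ∀ i, i ≤ k → MemAdd C (Y i) := fun i hi => by
    rcases Nat.eq_zero_or_pos i with rfl | h
    · exact hCZ
    · exact hCP.trans (hY i h hi)
  refine ⟨C, hC, ⟨hUC.finite, idimLE_of_extVan fun S => ?_, (extVanishing_iff _ _).2 fun j => ?_,
    Y, f, hf, hYD, hYC⟩, Y, f, hf, hYD, hYC, hY⟩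
  · refine hUC.extVan_right (extVan_prod_right (extVan_of_injective _ _ _) ?_)
    have := hd S 0
    rwa [show 0 + 1 + k = k + 1 by omega] at this
  · exact hUC.extVan_left (hUC.extVan_right (hP.extVan_prod (hZZ j)))

variable [FiniteDimensional K R]

theorem memAdd_Dreg_of_injective (I : ModuleCat.{0} R) [Module.Finite R I]
    [Module.Injective R I] : MemAdd (Dreg K R) I := by
  have := IsArtinianRing.of_finite K R
  obtain ⟨Y, u, hY, hu⟩ := exists_injective_memAdd (exists_Dreg_apply_ne_zero K I)
  obtain ⟨v, hv⟩ := Module.Injective.out u hu LinearMap.id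
  exact hY.trans (IsSummand.memAdd ⟨u, v, LinearMap.ext hv⟩)

variable {K}

theorem IsSpecialCotilting.exists_chain (hC : IsSpecialCotilting K P k C) (hP : ProjInj P)
    [Module.Finite R P] :
    ∃ t : ModuleCat.{0} R, Chain (MemAdd P) k t (Dreg K R) ∧ MemAdd C t ∧ MemAdd C P ∧
      MemAdd (ModuleCat.of R (P × t)) C := by
  obtain ⟨⟨hCf, hid, hext, -⟩, Y, f, hf, hYD, hYC, hYP⟩ := hC
  have hP1 := hP.1
  have hP2 := hP.2
  have hext := (extVanishing_iff _ _).1 hext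
  have ht : MemAdd C (Y 0) := hYC 0 (Nat.zero_le _)
  have c : Chain (fun Z => MemAdd C Z ∧ MemAdd P Z) k (Y 0) (Y (k + 1)) :=
    Chain.of_isExactSeq hf fun i h1 h2 => ⟨hYC i h2, hYP i h1 h2⟩
  rw [hYD] at c
  generalize Y 0 = t at c ht
  have cP : Chain (MemAdd P) k t (Dreg K R) := c.mono fun _ h => h.2
  have hDP := memAdd_Dreg_of_injective K P
  have hCP : MemAdd C P := by
    cases k with
    | zero =>
      cases c with
      | nil e => exact (ht.trans (IsSummand.of_equiv e.symm).memAdd).trans hDP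
    | succ k =>
      obtain ⟨L, Z, f, g, hs, hZ, -⟩ := c.exists_snoc
      obtain ⟨n, a, b, hab⟩ := memAdd_iff.1 hDP
      choose v hv using fun i => Module.projective_lifting_property g (b i) hs.surj
      refine hZ.1.trans (memAdd_of_sum (fun i => a i ∘ₗ g) v fun m => ?_)
      refine (Finset.sum_congr rfl fun i _ => ?_).trans (hab m)
      exact congrArg (a i) (LinearMap.congr_fun (hv i) m)
  have hCU : MemAdd C (ModuleCat.of R (P × t)) := hCP.prod ht
  have := hCU.finite
  have hPU := (isSummand_prod_left P t).memAdd
  have hE := fun j => hCU.extVan_left (hCU.extVan_right (hext j))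
  exact ⟨t, cP, ht, hCP, memAdd_of_cotilting_chain K (cP.mono fun _ h => hPU.trans h)
    (isSummand_prod_right P t).memAdd hE (fun j => hCU.extVan_right (hext j))
    (fun j => hCU.extVan_left (hext j)) k hid.extVan⟩

theorem IsSpecialCotilting.memAdd {C' : ModuleCat.{0} R} (hC : IsSpecialCotilting K P k C)
    (hC' : IsSpecialCotilting K P k C') (hP : ProjInj P) [Module.Finite R P] : MemAdd C C' := by
  obtain ⟨t, c, ht, hCP, hU⟩ := hC.exists_chain hP
  obtain ⟨t', c', ht', hCP', hU'⟩ := hC'.exists_chain hP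
  have hP1 := hP.1
  have := hC.1.1
  have := hC'.1.1
  have cross : ∀ {t t' C' : ModuleCat.{0} R}, Chain (MemAdd P) k t (Dreg K R) →
      MemAdd C' t' → IdimLE k C' → ∀ j, ExtVan t t' (j + 1) := fun c ht hid j =>
    c.extVan_start' (fun Y hY j => hY.extVan_left (extVan_of_projective _ _ _)) j
      (ht.extVan_right (hid.extVan _ j))
  refine memAdd_of_cotilting_chain K (c.mono fun _ h => hCP.trans h) ht
    ((extVanishing_iff _ _).1 hC.1.2.2.1) (fun j => ?_) (fun j => ?_) k hC'.1.2.1.extVan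
  · exact hU'.extVan_left (hU.extVan_right (hP.extVan_prod (cross c' ht hC.1.2.1 j)))
  · exact hU.extVan_left (hU'.extVan_right (hP.extVan_prod (cross c ht' hC'.1.2.1 j)))

end Cotilting

end PS

open PS in
/-- Proposition `shifting`.
Let `Γ` be a basic finite-dimensional algebra over a field with `domdim Γ ≥ k`, and let `Π`
(written `Pii`) be a maximal projective-injective direct summand of `Γ`.  Then there exists a
basic `Π`-special `k`-tilting `Γ`-module `T_k` and a basic `Π`-special `k`-cotilting `Γ`-module
`C^k`, and each of these modules is unique up to isomorphism. -/
theorem statement0 (K : Type) [Field K] (Γ : Type) [Ring Γ] [Algebra K Γ]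
    [FiniteDimensional K Γ] (hbasic : IsBasic (reg Γ)) (k : ℕ)
    (hdom : DomdimGE Γ k) (Pii : ModuleCat.{0} Γ) (hPii : IsMaxProjInjSummand Pii) :
    (∃ T : ModuleCat.{0} Γ, IsBasic T ∧ IsSpecialTilting Pii k T) ∧
    (∃ C : ModuleCat.{0} Γ, IsBasic C ∧ IsSpecialCotilting K Pii k C) ∧
    (∀ T T' : ModuleCat.{0} Γ, IsBasic T → IsSpecialTilting Pii k T →
      IsBasic T' → IsSpecialTilting Pii k T' → Nonempty (T ≃ₗ[Γ] T')) ∧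
    (∀ C C' : ModuleCat.{0} Γ, IsBasic C → IsSpecialCotilting K Pii k C →
      IsBasic C' → IsSpecialCotilting K Pii k C' → Nonempty (C ≃ₗ[Γ] C')) := by
  have := IsArtinianRing.of_finite K Γ
  have hR : Module.Finite Γ (reg Γ) := inferInstanceAs (Module.Finite Γ Γ)
  have := hPii.1.finite
  have hD := Dreg_finite K (R := Γ)
  have hD' := Dreg_injective K (R := Γ)
  obtain ⟨X, c⟩ := exists_chain_of_domdim (exists_finite_injective K) hPii hdom
  obtain ⟨Z, hZ, c'⟩ := c.exists_chain_end hPii.2.1 k le_rfl (Dreg K Γ)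
    fun j _ => extVan_of_injective _ _ _
  refine ⟨exists_isSpecialTilting hPii.2.1 c, exists_isSpecialCotilting K hPii.2.1 c',
    fun T T' hT hT₁ hT' hT₁' => ?_, fun C C' hC hC₁ hC' hC₁' => ?_⟩
  · have := hT₁.1.1
    have := hT₁'.1.1
    exact hT.nonempty_equiv hT' (hT₁'.memAdd K hT₁ hPii.2.1 hPii.1)
      (hT₁.memAdd K hT₁' hPii.2.1 hPii.1)
  · have := hC₁.1.1
    have := hC₁'.1.1
    exact hC.nonempty_equiv hC' (hC₁'.memAdd hC₁ hPii.2.1) (hC₁.memAdd hC₁' hPii.2.1)
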